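/- Let r ≥ 3 be an integer and let G be an extremal 𝓕_{2r}-free coloured graph on n vertices with δ(G) > ((14r−24)/(7r−5))·n. If G contains no blue wicked triangle, then every edge of G of weight 0 is secure. -/

import Mathlib

/-- A coloured graph structure on a weight function: symmetric, `{0,1,2}`-valued,
vanishing on the diagonal. -/
def IsColoured {V : Type*} (w : V → V → ℕ) : Prop :=
  (∀ x y, w x y = w y x) ∧ (∀ x y, w x y ≤ 2) ∧ (∀ x, w x x = 0)

/-- The coloured graph with weight function `f` on `Fin m` is a subgraph of `(V, w)`. -/
def HasSub {V : Type*} (w : V → V → ℕ) {m : ℕ} (f : Fin m → Fin m → ℕ) : Prop :=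
  ∃ φ : Fin m → V, Function.Injective φ ∧ ∀ x y, f x y ≤ w (φ x) (φ y)

/-- The red clique `RK_m`: every edge has weight `2`. -/
def RK (m : ℕ) : Fin m → Fin m → ℕ := fun x y => if x = y then 0 else 2

/-- The blue clique `BK_m`: every edge has weight `1`. -/
def BK (m : ℕ) : Fin m → Fin m → ℕ := fun x y => if x = y then 0 else 1

/-- The coloured graph `G_{t,i}` of order `t - i`: a red clique `RK_i` (the first `i`
vertices) and a blue clique `BK_{t-2i}`, joined by edges of weight `1`. -/
def Gt (t i : ℕ) : Fin (t - i) → Fin (t - i) → ℕ :=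
  fun x y => if x = y then 0 else if x.val < i ∧ y.val < i then 2 else 1

/-- `(V, w)` is `𝓕_t`-free, where `𝓕_t = {G_{t,i} : 1 ≤ i ≤ t/2}`. -/
def FamFree {V : Type*} (w : V → V → ℕ) (t : ℕ) : Prop :=
  ∀ i, 1 ≤ i → 2 * i ≤ t → ¬ HasSub w (Gt t i)

/-- An `𝓕_{2r}`-free coloured graph `(V, w)` is extremal if every `𝓕_{2r}`-free coloured
graph on `V` whose weight function pointwise dominates `w` coincides with `w`. -/
def Extremal {V : Type*} (w : V → V → ℕ) (r : ℕ) : Prop :=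
  FamFree w (2 * r) ∧
    ∀ w' : V → V → ℕ, IsColoured w' → (∀ x y, w x y ≤ w' x y) → FamFree w' (2 * r) → w' = w

/-- A pair of distinct vertices `x, y` is secure if it lies in the common red
neighbourhood of some red clique on `r - 2` vertices. -/
def Secure {V : Type*} (w : V → V → ℕ) (r : ℕ) (x y : V) : Prop :=
  ∃ A : Finset V, A.card = r - 2 ∧ x ∉ A ∧ y ∉ A ∧
    (∀ a ∈ A, ∀ a' ∈ A, a ≠ a' → w a a' = 2) ∧ (∀ a ∈ A, w a x = 2 ∧ w a y = 2)

section

open Finset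

/-- Any two distinct vertices of `S` are joined by an edge of positive weight. -/
def PosClique {V : Type*} (w : V → V → ℕ) (S : Finset V) : Prop :=
  ∀ u ∈ S, ∀ v ∈ S, u ≠ v → 1 ≤ w u v

/-- Any two distinct vertices of `S` are joined by an edge of weight `2`. -/
def RedClique {V : Type*} (w : V → V → ℕ) (S : Finset V) : Prop :=
  ∀ u ∈ S, ∀ v ∈ S, u ≠ v → w u v = 2

/-- Any two distinct vertices of `S` are joined by an edge of weight `1`. -/
def BlueClique {V : Type*} (w : V → V → ℕ) (S : Finset V) : Prop :=
  ∀ u ∈ S, ∀ v ∈ S, u ≠ v → w u v = 1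

/-- All edges between `S` and `T` have weight `2`. -/
def RedBetween {V : Type*} (w : V → V → ℕ) (S T : Finset V) : Prop :=
  ∀ u ∈ S, ∀ v ∈ T, w u v = 2

/-- `S` is a clique of positive edges whose order plus the order of some red clique
inside it is at least `m`. -/
def HasValue {V : Type*} (w : V → V → ℕ) (S : Finset V) (m : ℕ) : Prop :=
  PosClique w S ∧ ∃ R ⊆ S, RedClique w R ∧ m ≤ R.card + S.card

/-- The consequences of freeness, of the degree condition and of the absence of blue wicked
triangles on which the argument rests. -/
structure DenseFree {V : Type*} [Fintype V] (w : V → V → ℕ) (r : ℕ) : Prop where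
  symm : ∀ x y, w x y = w y x
  le_two : ∀ x y, w x y ≤ 2
  self : ∀ x, w x x = 0
  noWicked : ∀ {u v z}, w u v = 2 → w z u = 1 → w z v = 1 → False
  free : ∀ S, ¬ HasValue w S (2 * r)
  three_le : 3 ≤ r
  defect_lt : ∀ v, (7 * (r : ℝ) - 5) * ∑ z, (2 - (w z v : ℝ)) < 14 * (Fintype.card V : ℝ)

lemma HasValue.mono {V : Type*} {w : V → V → ℕ} {S : Finset V} {m m' : ℕ}
    (h : HasValue w S m) (hm : m' ≤ m) : HasValue w S m' := by
  obtain ⟨h1, R, h2, h3, h4⟩ := h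
  exact ⟨h1, R, h2, h3, hm.trans h4⟩

lemma not_hasValue_of_famFree {V : Type*} [DecidableEq V] {w : V → V → ℕ} {r : ℕ} (hr : 3 ≤ r)
    (hfree : FamFree w (2 * r)) (S : Finset V) : ¬ HasValue w S (2 * r) := by
  rintro ⟨hS, R, hRS, hR, hm⟩
  obtain ⟨R', S', h1, h2, h3, hR', hRS', hS'⟩ : ∃ R' S' : Finset V, 1 ≤ R'.card ∧
      2 * R'.card ≤ 2 * r ∧ S'.card = 2 * r - R'.card ∧ RedClique w R' ∧ R' ⊆ S' ∧
      PosClique w S' := by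
    by_cases hc : r ≤ R.card
    · obtain ⟨R', h, h'⟩ := exists_subset_card_eq hc
      refine ⟨R', R', by omega, by omega, by omega, fun u hu v hv => hR u (h hu) v (h hv),
        Subset.rfl, fun u hu v hv => hS u (hRS (h hu)) v (hRS (h hv))⟩
    obtain ⟨R', h1, h2, h3, h4⟩ : ∃ R' ⊆ S, 1 ≤ R'.card ∧ RedClique w R' ∧ R'.card < r ∧
        2 * r ≤ R'.card + S.card := by
      by_cases h0 : R.card = 0
      · obtain ⟨s, hs⟩ : S.Nonempty := card_pos.1 (by omega)
        refine ⟨{s}, by simpa using hs, by simp, ?_, by simp; omega, by simp; omega⟩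
        intro u hu v hv huv
        simp_all
      · exact ⟨R, hRS, by omega, hR, by omega, hm⟩
    obtain ⟨h5, h6⟩ := h4
    obtain ⟨S', h7, h8, h9⟩ := exists_subsuperset_card_eq h1 (n := 2 * r - R'.card)
      (by omega) (by omega)
    exact ⟨R', S', h2, by omega, h9, h3, h7, fun u hu v hv => hS u (h8 hu) v (h8 hv)⟩
  refine hfree R'.card h1 h2 ?_
  set l := R'.toList ++ (S' \ R').toList with hl
  have hlen : l.length = 2 * r - R'.card := by
    have := card_le_card hRS'
    simp only [hl, List.length_append, length_toList, card_sdiff_of_subset hRS']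
    omega
  have hnd : l.Nodup := by
    rw [hl, List.nodup_append]
    refine ⟨nodup_toList _, nodup_toList _, ?_⟩
    intro a ha b hb hab
    subst hab
    simp at ha hb
    exact hb.2 ha
  have hval : ∀ c : Fin (2 * r - R'.card), c.val < l.length := fun c => by
    rw [hlen]; exact c.2
  have hmem : ∀ a ∈ l, a ∈ S' := by
    intro a ha
    simp [hl] at ha
    rcases ha with ha | ha
    · exact hRS' ha
    · exact ha.1
  refine ⟨fun a => l[a.val]'(hval a), ?_, ?_⟩
  · intro a b hab
    exact Fin.ext ((hnd.getElem_inj_iff).1 hab)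
  · intro a b
    by_cases hab : a = b
    · simp [Gt, hab]
    have hne : l[a.val]'(hval a) ≠ l[b.val]'(hval b) :=
      fun h => hab (Fin.ext ((hnd.getElem_inj_iff).1 h))
    have hin : ∀ c : Fin (2 * r - R'.card), c.val < R'.card →
        l[c.val]'(hval c) ∈ R' := by
      intro c hc
      have : l[c.val]'(hval c) = R'.toList[c.val]'(by simpa using hc) := by
        simp only [hl]
        rw [List.getElem_append_left]
      rw [this, ← mem_toList]
      exact List.getElem_mem _
    by_cases hc : a.val < R'.card ∧ b.val < R'.card
    · simp only [Gt, hab, hc, if_false, and_self, if_true]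
      exact (hR' _ (hin a hc.1) _ (hin b hc.2) hne).ge
    · simp only [Gt, hab, hc, if_false]
      exact hS' _ (hmem _ (List.getElem_mem _)) _ (hmem _ (List.getElem_mem _)) hne

lemma Secure.symm {V : Type*} {w : V → V → ℕ} {r : ℕ} {x y : V}
    (h : Secure w r x y) : Secure w r y x := by
  obtain ⟨A, h1, h2, h3, h4, h5⟩ := h
  exact ⟨A, h1, h3, h2, h4, fun a ha => (h5 a ha).symm⟩

lemma RedBetween.insert_left {V : Type*} [DecidableEq V] {w : V → V → ℕ} {S T : Finset V}
    {z : V} (hz : ∀ v ∈ T, w z v = 2)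
    (h : RedBetween w S T) : RedBetween w (insert z S) T := by
  intro u hu v hv
  rcases mem_insert.1 hu with rfl | hu
  · exact hz v hv
  · exact h u hu v hv

namespace DenseFree

variable {V : Type*} [Fintype V] {w : V → V → ℕ} {r : ℕ}

lemma weight_cases (H : DenseFree w r) (u v : V) : w u v = 0 ∨ w u v = 1 ∨ w u v = 2 := by
  have := H.le_two u v
  omega

lemma defect_nonneg (H : DenseFree w r) (u v : V) : (0 : ℝ) ≤ 2 - (w u v : ℝ) := by
  have : (w u v : ℝ) ≤ 2 := by exact_mod_cast H.le_two u v
  linarith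

lemma not_red_of_blue (H : DenseFree w r) {u v z : V} (huv : w u v = 1) (h : w z u = 1) :
    w z v ≠ 2 := by
  intro h'
  exact H.noWicked h' (by rw [H.symm, h]) huv

lemma not_blue_of_red (H : DenseFree w r) {u v z : V} (huv : w u v = 1) (h : w z u = 2) :
    w z v ≠ 1 := by
  intro h'
  exact H.not_red_of_blue (by rw [H.symm, huv]) h' h

lemma redBetween_comm (H : DenseFree w r) {S T : Finset V} (h : RedBetween w S T) :
    RedBetween w T S := fun u hu v hv => by rw [H.symm, h v hv u hu]

lemma secure_of_redClique (H : DenseFree w r) {x y : V} {R : Finset V} (hR : RedClique w R)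
    (hx : ∀ v ∈ R, w x v = 2) (hy : ∀ v ∈ R, w y v = 2) (hc : r ≤ R.card + 2) :
    Secure w r x y := by
  obtain ⟨A, hA, hc⟩ := exists_subset_card_eq (show r - 2 ≤ R.card by omega)
  refine ⟨A, hc, fun h => ?_, fun h => ?_, fun a ha b hb => hR a (hA ha) b (hA hb),
    fun a ha => ⟨by rw [H.symm, hx a (hA ha)], by rw [H.symm, hy a (hA ha)]⟩⟩
  · have := hx _ (hA h); rw [H.self] at this; omega
  · have := hy _ (hA h); rw [H.self] at this; omega

lemma notMem_of_pos (H : DenseFree w r) {S : Finset V} {z : V} (hz : ∀ v ∈ S, 1 ≤ w z v) :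
    z ∉ S := fun h => by
  have := hz z h
  rw [H.self] at this
  omega

lemma one_le_defect (H : DenseFree w r) {z v : V} (h : w z v ≠ 2) :
    (1 : ℝ) ≤ 2 - (w z v : ℝ) := by
  have h1 := H.le_two z v
  have h2 : (w z v : ℝ) ≤ 1 := by exact_mod_cast (show w z v ≤ 1 by omega)
  linarith

lemma two_le_defect (_ : DenseFree w r) {z v : V} (h : w z v = 0) :
    (2 : ℝ) ≤ 2 - (w z v : ℝ) := by
  simp [h]

lemma defect_sum_nonneg (H : DenseFree w r) (z : V) (P : Finset V) :
    (0 : ℝ) ≤ ∑ v ∈ P, (2 - (w z v : ℝ)) := sum_nonneg fun v _ => H.defect_nonneg z v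

lemma le_defect_sum (H : DenseFree w r) (z : V) {P : Finset V} {a : V} (ha : a ∈ P) :
    2 - (w z a : ℝ) ≤ ∑ v ∈ P, (2 - (w z v : ℝ)) :=
  single_le_sum (f := fun v => 2 - (w z v : ℝ)) (fun v _ => H.defect_nonneg z v) ha

/-- If the total weight distributed is at most `r - 5/7`, then some vertex has weighted
defect less than `2`. -/
lemma exists_small_defect (H : DenseFree w r) (E P Q : Finset V) (x y : V) (f : V → ℝ)
    (γ κ β η : ℝ) (hf : ∀ v, 0 ≤ f v) (hγ : 0 ≤ γ) (hκ : 0 ≤ κ) (hβ : 0 < β) (hη : 0 ≤ η)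
    (ht : ∑ v ∈ E, f v + γ * P.card + κ * Q.card + β + η ≤ r - 5 / 7) :
    ∃ z, ∑ v ∈ E, f v * (2 - (w z v : ℝ)) + γ * ∑ v ∈ P, (2 - (w z v : ℝ)) +
      κ * ∑ v ∈ Q, (2 - (w z v : ℝ)) + β * (2 - (w z x : ℝ)) + η * (2 - (w z y : ℝ)) < 2 := by
  by_contra! h
  have hr : (3 : ℝ) ≤ r := by exact_mod_cast H.three_le
  have hk : (0 : ℝ) < 7 * r - 5 := by linarith
  set d : V → ℝ := fun v => ∑ z, (2 - (w z v : ℝ)) with hd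
  set D : ℝ := 14 * (Fintype.card V : ℝ) / (7 * r - 5) with hD
  have hlt : ∀ v, d v < D := fun v => by
    rw [hD, lt_div_iff₀ hk, mul_comm]
    exact H.defect_lt v
  have hsum := sum_le_sum (s := univ) fun z (_ : z ∈ univ) => h z
  have h1 : ∑ z, ∑ v ∈ E, f v * (2 - (w z v : ℝ)) = ∑ v ∈ E, f v * d v := by
    rw [sum_comm]
    simp only [hd, mul_sum]
  have h2 : ∀ P : Finset V, ∑ z, ∑ v ∈ P, (2 - (w z v : ℝ)) = ∑ v ∈ P, d v :=
    fun P => sum_comm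
  simp only [sum_add_distrib, ← mul_sum, h1, h2, sum_const, card_univ, nsmul_eq_mul] at hsum
  have h3 : ∑ v ∈ E, f v * d v ≤ (∑ v ∈ E, f v) * D := by
    rw [sum_mul]
    exact sum_le_sum fun v _ => mul_le_mul_of_nonneg_left (hlt v).le (hf v)
  have h4 : ∀ P : Finset V, ∑ v ∈ P, d v ≤ P.card * D := fun P => by
    have := sum_le_card_nsmul P d D fun v _ => (hlt v).le
    simpa using this
  have h5 := mul_le_mul_of_nonneg_left (h4 P) hγ
  have h6 := mul_le_mul_of_nonneg_left (h4 Q) hκ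
  have h7 := mul_lt_mul_of_pos_left (hlt x) hβ
  have h8 := mul_le_mul_of_nonneg_left (hlt y).le hη
  have hD0 : 0 ≤ D := by positivity
  have h9 := mul_le_mul_of_nonneg_right ht hD0
  have h10 : (r - 5 / 7) * D = 2 * (Fintype.card V : ℝ) := by
    rw [hD, mul_div_assoc', div_eq_iff hk.ne']
    ring
  simp only [hd] at h7 h8
  nlinarith

/-- Both `x` and `y` are red to `E`; moreover `x` is blue to the blue clique `P` and red to the
blue clique `Q`, while `y` is red to `P` and blue to `Q`. All edges between two of the sets
`E`, `P`, `Q` are red. -/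
structure BluePairs {V : Type*} (w : V → V → ℕ) (x y : V) (E P Q : Finset V) : Prop where
  bluex : ∀ v ∈ P, w x v = 1
  bluey : ∀ v ∈ Q, w y v = 1
  bluep : BlueClique w P
  blueq : BlueClique w Q
  redx : ∀ v ∈ E, w x v = 2
  redy : ∀ v ∈ E, w y v = 2
  redxq : ∀ v ∈ Q, w x v = 2
  redyp : ∀ v ∈ P, w y v = 2
  redp : RedBetween w E P
  redq : RedBetween w E Q
  redpq : RedBetween w P Q

lemma BluePairs.swap (H : DenseFree w r) {x y : V} {E P Q : Finset V}
    (h : BluePairs w x y E P Q) : BluePairs w y x E Q P :=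
  ⟨h.bluey, h.bluex, h.blueq, h.bluep, h.redy, h.redx, h.redyp, h.redxq, h.redq, h.redp,
    H.redBetween_comm h.redpq⟩

lemma BluePairs.mono {V : Type*} {w : V → V → ℕ} {x y : V} {E P Q E' P' Q' : Finset V}
    (h : BluePairs w x y E P Q)
    (hE : E' ⊆ E) (hP : P' ⊆ P) (hQ : Q' ⊆ Q) : BluePairs w x y E' P' Q' where
  bluex v hv := h.bluex v (hP hv)
  bluey v hv := h.bluey v (hQ hv)
  bluep u hu v hv := h.bluep u (hP hu) v (hP hv)
  blueq u hu v hv := h.blueq u (hQ hu) v (hQ hv)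
  redx v hv := h.redx v (hE hv)
  redy v hv := h.redy v (hE hv)
  redxq v hv := h.redxq v (hQ hv)
  redyp v hv := h.redyp v (hP hv)
  redp u hu v hv := h.redp u (hE hu) v (hP hv)
  redq u hu v hv := h.redq u (hE hu) v (hQ hv)
  redpq u hu v hv := h.redpq u (hP hu) v (hQ hv)

lemma BluePairs.singleton (H : DenseFree w r) {x y z : V} {E P : Finset V}
    (h : BluePairs w x y E P ∅) (hzE : ∀ v ∈ E, w z v = 2) (hzP : ∀ v ∈ P, w z v = 2)
    (hx : w z x = 2) (hy : w z y = 1) : BluePairs w x y E P {z} where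
  bluex := h.bluex
  bluey v hv := by rw [mem_singleton.1 hv, H.symm, hy]
  bluep := h.bluep
  blueq u hu v hv huv := absurd ((mem_singleton.1 hu).trans (mem_singleton.1 hv).symm) huv
  redx := h.redx
  redy := h.redy
  redxq v hv := by rw [mem_singleton.1 hv, H.symm, hx]
  redyp := h.redyp
  redp := h.redp
  redq u hu v hv := by rw [mem_singleton.1 hv, H.symm, hzE u hu]
  redpq u hu v hv := by rw [mem_singleton.1 hv, H.symm, hzP u hu]

lemma BluePairs.empty {V : Type*} {w : V → V → ℕ} {x y : V} {E : Finset V}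
    (hx : ∀ v ∈ E, w x v = 2) (hy : ∀ v ∈ E, w y v = 2) : BluePairs w x y E ∅ ∅ := by
  constructor <;> simp_all [BlueClique, RedBetween]

lemma card_inter_le_one {V : Type*} [DecidableEq V] {w : V → V → ℕ} {R T : Finset V}
    (hR : RedClique w R) (hT : ∀ u ∈ T, ∀ v ∈ T, u ≠ v → w u v ≠ 2) : (R ∩ T).card ≤ 1 := by
  refine card_le_one.2 fun u hu v hv => ?_
  rw [mem_inter] at hu hv
  by_contra huv
  exact hT u hu.2 v hv.2 huv (hR u hu.1 v hv.1 huv)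

lemma blueClique_filter (H : DenseFree w r) {D : Finset V} (hD : PosClique w D) (x : V) :
    BlueClique w {v ∈ D | w x v = 1} := by
  intro u hu v hv huv
  rw [mem_filter] at hu hv
  have h1 := hD u hu.1 v hv.1 huv
  have h2 := H.le_two u v
  have h3 : w u v ≠ 2 := H.not_red_of_blue hv.2 (by rw [H.symm, hu.2])
  omega

lemma red_of_blue_of_red (H : DenseFree w r) {u v x : V} (hu : w x u = 1) (hv : w x v = 2)
    (huv : 1 ≤ w u v) : w u v = 2 := by
  have h1 := H.le_two u v
  have h2 : w v u ≠ 1 := H.not_blue_of_red hu (by rw [H.symm, hv])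
  rw [H.symm] at h2
  omega

variable [DecidableEq V]

lemma posClique_insert (H : DenseFree w r) {S : Finset V} {z : V} (hS : PosClique w S)
    (hz : ∀ v ∈ S, 1 ≤ w z v) : PosClique w (insert z S) := by
  intro u hu v hv huv
  rw [mem_insert] at hu hv
  rcases hu with rfl | hu <;> rcases hv with rfl | hv
  · exact absurd rfl huv
  · exact hz v hv
  · rw [H.symm]; exact hz u hu
  · exact hS u hu v hv huv

lemma redClique_insert (H : DenseFree w r) {S : Finset V} {z : V} (hS : RedClique w S)
    (hz : ∀ v ∈ S, w z v = 2) : RedClique w (insert z S) := by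
  intro u hu v hv huv
  rw [mem_insert] at hu hv
  rcases hu with rfl | hu <;> rcases hv with rfl | hv
  · exact absurd rfl huv
  · exact hz v hv
  · rw [H.symm]; exact hz u hu
  · exact hS u hu v hv huv

lemma blueClique_insert (H : DenseFree w r) {S : Finset V} {z : V} (hS : BlueClique w S)
    (hz : ∀ v ∈ S, w z v = 1) : BlueClique w (insert z S) := by
  intro u hu v hv huv
  rw [mem_insert] at hu hv
  rcases hu with rfl | hu <;> rcases hv with rfl | hv
  · exact absurd rfl huv
  · exact hz v hv
  · rw [H.symm]; exact hz u hu
  · exact hS u hu v hv huv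

lemma hasValue_insert_pos (H : DenseFree w r) {S : Finset V} {z : V} {m : ℕ}
    (hS : HasValue w S m) (hz : ∀ v ∈ S, 1 ≤ w z v) : HasValue w (insert z S) (m + 1) := by
  obtain ⟨h1, R, h2, h3, h4⟩ := hS
  refine ⟨H.posClique_insert h1 hz, R, h2.trans (subset_insert _ _), h3, ?_⟩
  rw [card_insert_of_notMem (H.notMem_of_pos hz)]
  omega

lemma hasValue_insert_red (H : DenseFree w r) {S : Finset V} {z : V} {m : ℕ}
    (hS : HasValue w S m) (hz : ∀ v ∈ S, w z v = 2) : HasValue w (insert z S) (m + 2) := by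
  obtain ⟨h1, R, h2, h3, h4⟩ := hS
  have hz' : ∀ v ∈ S, 1 ≤ w z v := fun v hv => by rw [hz v hv]; omega
  have hzS := H.notMem_of_pos hz'
  refine ⟨H.posClique_insert h1 hz', insert z R, insert_subset_insert _ h2,
    H.redClique_insert h3 fun v hv => hz v (h2 hv), ?_⟩
  rw [card_insert_of_notMem hzS, card_insert_of_notMem fun h => hzS (h2 h)]
  omega

lemma hasValue_union_blue (H : DenseFree w r) {S Q : Finset V} {m : ℕ}
    (hS : HasValue w S m) (hQ : BlueClique w Q) (hne : Q.Nonempty) (hSQ : RedBetween w S Q) :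
    HasValue w (S ∪ Q) (m + Q.card + 1) := by
  obtain ⟨h1, R, h2, h3, h4⟩ := hS
  obtain ⟨q, hq⟩ := hne
  have hd : Disjoint S Q := by
    rw [disjoint_left]
    intro a ha hb
    have := hSQ a ha a hb
    rw [H.self] at this
    omega
  have hqS : q ∉ R := fun h => disjoint_left.1 hd (h2 h) hq
  refine ⟨?_, insert q R, insert_subset (mem_union_right _ hq) (h2.trans subset_union_left),
    H.redClique_insert h3 fun v hv => by rw [H.symm, hSQ v (h2 hv) q hq], ?_⟩
  · intro u hu v hv huv
    rw [mem_union] at hu hv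
    rcases hu with hu | hu <;> rcases hv with hv | hv
    · exact h1 u hu v hv huv
    · rw [hSQ u hu v hv]; omega
    · rw [H.symm, hSQ v hv u hu]; omega
    · rw [hQ u hu v hv huv]
  · rw [card_union_of_disjoint hd, card_insert_of_notMem hqS]
    omega

lemma hasValue_union_two_blue (H : DenseFree w r) {S Q T : Finset V} {m : ℕ}
    (hS : HasValue w S m) (hQ : BlueClique w Q) (hne : Q.Nonempty) (hSQ : RedBetween w S Q)
    (hT : BlueClique w T) (hne' : T.Nonempty) (hST : RedBetween w S T)
    (hQT : RedBetween w Q T) : HasValue w (S ∪ Q ∪ T) (m + Q.card + 1 + T.card + 1) := by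
  refine H.hasValue_union_blue (H.hasValue_union_blue hS hQ hne hSQ) hT hne' ?_
  intro u hu
  rcases mem_union.1 hu with hu | hu
  · exact hST u hu
  · exact hQT u hu

lemma value_add_two_blue_lt (H : DenseFree w r) {S Q T : Finset V} {m : ℕ}
    (hS : HasValue w S m) (hQ : BlueClique w Q) (hne : Q.Nonempty) (hSQ : RedBetween w S Q)
    (hT : BlueClique w T) (hne' : T.Nonempty) (hST : RedBetween w S T)
    (hQT : RedBetween w Q T) : m + Q.card + 1 + T.card + 1 < 2 * r := by
  by_contra! h
  exact H.free _ ((H.hasValue_union_two_blue hS hQ hne hSQ hT hne' hST hQT).mono h)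

lemma le_defect_sum_pair (H : DenseFree w r) (z : V) {P : Finset V} {a b : V} (ha : a ∈ P)
    (hb : b ∈ P.erase a) :
    (2 - (w z a : ℝ)) + (2 - (w z b : ℝ)) ≤ ∑ v ∈ P, (2 - (w z v : ℝ)) := by
  rw [← add_sum_erase P _ ha]
  have := H.le_defect_sum z hb
  linarith

lemma le_defect_sum_triple (H : DenseFree w r) (z : V) {P : Finset V} {a b c : V} (ha : a ∈ P)
    (hb : b ∈ P.erase a) (hc : c ∈ (P.erase a).erase b) :
    (2 - (w z a : ℝ)) + (2 - (w z b : ℝ)) + (2 - (w z c : ℝ)) ≤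
      ∑ v ∈ P, (2 - (w z v : ℝ)) := by
  rw [← add_sum_erase P _ ha]
  have := H.le_defect_sum_pair z hb hc
  linarith

/-- A red clique of maximum order in a positive clique gives rise to a partition of the positive
clique into blue cliques, with red edges between different parts. -/
lemma exists_transversal (H : DenseFree w r) {S : Finset V} (hS : PosClique w S) :
    ∃ R ⊆ S, RedClique w R ∧ (∀ R' ⊆ S, RedClique w R' → R'.card ≤ R.card) ∧
      ∃ ρ : V → V, (∀ v ∈ S, ρ v ∈ R) ∧ (∀ v ∈ R, ρ v = v) ∧
        (∀ u ∈ S, ∀ v ∈ S, u ≠ v → ρ u = ρ v → w u v = 1) ∧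
        (∀ u ∈ S, ∀ v ∈ S, ρ u ≠ ρ v → w u v = 2) := by
  classical
  obtain ⟨R, hR, hmax⟩ := exists_max_image (S.powerset.filter fun R => RedClique w R) card
    ⟨∅, mem_filter.2 ⟨empty_mem_powerset _, by simp [RedClique]⟩⟩
  simp only [mem_filter, mem_powerset, and_imp] at hR hmax
  obtain ⟨hRS, hR⟩ := hR
  have hex : ∀ v ∈ S, ∃ a ∈ R, w v a ≠ 2 := by
    intro v hv
    by_contra! h
    have hvR : v ∉ R := H.notMem_of_pos fun u hu => by rw [h u hu]; omega
    have := hmax (insert v R) (insert_subset hv hRS) (H.redClique_insert hR h)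
    rw [card_insert_of_notMem hvR] at this
    omega
  choose! ρ hρ hρw using hex
  have hfix : ∀ v ∈ R, ρ v = v := by
    intro v hv
    by_contra h
    exact hρw v (hRS hv) (hR v hv _ (hρ v (hRS hv)) (Ne.symm h))
  have hblue : ∀ v ∈ S, v ≠ ρ v → w v (ρ v) = 1 := by
    intro v hv h
    have h1 := hS v hv _ (hRS (hρ v hv)) h
    have h2 := hρw v hv
    have h3 := H.le_two v (ρ v)
    omega
  refine ⟨R, hRS, hR, hmax, ρ, hρ, hfix, ?_, ?_⟩
  · intro u hu v hv huv h
    have h1 := hS u hu v hv huv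
    have h2 : w u v ≠ 2 := by
      intro h2
      by_cases hu' : u = ρ u
      · exact hρw v hv (by rw [← h, ← hu', H.symm, h2])
      by_cases hv' : v = ρ v
      · exact hρw u hu (by rw [h, ← hv', h2])
      · refine H.noWicked h2 (z := ρ u) ?_ ?_
        · rw [H.symm, hblue u hu hu']
        · rw [h, H.symm, hblue v hv hv']
    have h3 := H.le_two u v
    omega
  · have key : ∀ u ∈ S, ∀ b ∈ R, ρ u ≠ b → w u b = 2 := by
      intro u hu b hb h
      have hab := hR _ (hρ u hu) b hb h
      by_cases hu' : u = ρ u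
      · rw [hu', hab]
      · have hub : u ≠ b := fun hub => hu' (by rw [hub, hfix b hb])
        have h1 := hS u hu b (hRS hb) hub
        have h2 := H.le_two u b
        have h3 : w u b ≠ 1 := fun h3 => H.noWicked hab (hblue u hu hu') h3
        omega
    intro u hu v hv h
    have h1 := key u hu _ (hρ v hv) h
    by_cases hv' : v = ρ v
    · rw [hv', h1]
    · have huv : u ≠ v := fun huv => h (by rw [huv])
      have h2 := hS u hu v hv huv
      have h3 := H.le_two u v
      have h4 : w u v ≠ 1 := fun h4 => H.noWicked h1 (z := v)
        (by rw [H.symm, h4]) (hblue v hv hv')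
      omega

/-- The weight of a vertex lying in a blue class of order `q`. -/
noncomputable def classWeight (q : ℕ) : ℝ := if q = 1 then 1 else if q = 2 then 2 / 3 else 1 / 2

lemma half_le_classWeight (q : ℕ) : 1 / 2 ≤ classWeight q := by
  unfold classWeight
  split_ifs <;> norm_num

lemma one_le_mul_classWeight {q : ℕ} (hq : 1 ≤ q) : 1 ≤ q * classWeight q := by
  unfold classWeight
  split_ifs with h1 h2
  · simp [h1]
  · simp [h2]; norm_num
  · have : (3 : ℝ) ≤ q := by exact_mod_cast (show 3 ≤ q by omega)
    linarith

lemma two_le_mul_classWeight {q : ℕ} (hq : 1 ≤ q) : 2 ≤ (q + 1) * classWeight q := by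
  unfold classWeight
  split_ifs with h1 h2
  · simp [h1]; norm_num
  · simp [h2]; norm_num
  · have : (3 : ℝ) ≤ q := by exact_mod_cast (show 3 ≤ q by omega)
    linarith

lemma mul_classWeight_le (q : ℕ) : q * classWeight q ≤ (q + 1) / 2 := by
  unfold classWeight
  split_ifs with h1 h2
  · simp [h1]
  · simp [h2]; norm_num
  · linarith

lemma mul_classWeight_le_of_two_lt {q : ℕ} (hq : 2 < q) :
    q * classWeight q ≤ (q + 1) / 2 - 1 / 2 := by
  unfold classWeight
  split_ifs with h1 h2
  · omega
  · omega
  · linarith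

lemma mul_classWeight_le_of_le_two {q : ℕ} (hq : 1 ≤ q) (h : q ≤ 2) :
    q * classWeight q ≤ (q + 1) / 2 - (q - 1) / 6 := by
  unfold classWeight
  interval_cases q <;> norm_num

/-- The vertices of a positive clique can be weighted in such a way that vertices of small
weighted defect increase the value of the clique. -/
lemma exists_weights (H : DenseFree w r) {S : Finset V} (hS : PosClique w S) :
    ∃ R ⊆ S, RedClique w R ∧ (∀ R' ⊆ S, RedClique w R' → R'.card ≤ R.card) ∧
      ∃ f : V → ℝ, (∀ v, 0 ≤ f v) ∧
        (∑ v ∈ S, f v ≤ ((R.card : ℝ) + S.card) / 2 - 1 / 3 ∨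
          ∑ v ∈ S, f v ≤ ((R.card : ℝ) + S.card) / 2 - ((S.card : ℝ) - R.card) / 6) ∧
        ∀ z, ∑ v ∈ S, f v * (2 - (w z v : ℝ)) < 2 →
          (∀ v ∈ S, w z v = 2) ∨
          (1 ≤ ∑ v ∈ S, f v * (2 - (w z v : ℝ)) ∧ (∃ a ∈ S, w z a = 1) ∧
            ∀ v ∈ S, 1 ≤ w z v) ∨
          (1 ≤ ∑ v ∈ S, f v * (2 - (w z v : ℝ)) ∧ ∃ e ∈ S, w z e = 0 ∧
            (∀ v ∈ S.erase e, w z v = 2) ∧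
            HasValue w (S.erase e) (R.card + S.card - 1)) := by
  obtain ⟨R, hRS, hR, hmax, ρ, hρ, hfix, hsame, hdiff⟩ := H.exists_transversal hS
  set F : V → Finset V := fun a => S.filter fun u => ρ u = a with hF
  set f : V → ℝ := fun v => classWeight (F (ρ v)).card with hf
  have hf2 : ∀ v, 1 / 2 ≤ f v := fun v => half_le_classWeight _
  have hf0 : ∀ v, 0 ≤ f v := fun v => le_trans (by norm_num) (hf2 v)
  have hself : ∀ v ∈ S, v ∈ F (ρ v) := fun v hv => by simp [hF, hv]
  have hq1 : ∀ v ∈ S, 1 ≤ (F (ρ v)).card := fun v hv => card_pos.2 ⟨v, hself v hv⟩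
  refine ⟨R, hRS, hR, hmax, f, hf0, ?_, ?_⟩
  · have hsum : ∑ v ∈ S, f v = ∑ a ∈ R, (F a).card * classWeight (F a).card := by
      rw [← sum_fiberwise_of_maps_to hρ]
      refine sum_congr rfl fun a _ => ?_
      rw [← nsmul_eq_mul, ← sum_const]
      refine sum_congr rfl fun v hv => ?_
      simp only [hf, (mem_filter.1 hv).2]
    have hcard : (S.card : ℝ) = ∑ a ∈ R, ((F a).card : ℝ) := by
      exact_mod_cast card_eq_sum_card_fiberwise hρ
    have hqR : ∀ a ∈ R, 1 ≤ (F a).card := fun a ha => by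
      have := hq1 a (hRS ha)
      rwa [hfix a ha] at this
    have hhalf : ∑ a ∈ R, (((F a).card : ℝ) + 1) / 2 = ((R.card : ℝ) + S.card) / 2 := by
      rw [← sum_div, sum_add_distrib, ← hcard]
      simp [add_comm]
    rw [hsum]
    by_cases h : ∃ a ∈ R, 2 < (F a).card
    · left
      obtain ⟨a, ha, h2⟩ := h
      rw [← hhalf, ← add_sum_erase R _ ha,
        ← add_sum_erase R (fun a => (((F a).card : ℝ) + 1) / 2) ha]
      have h3 := mul_classWeight_le_of_two_lt h2
      have h4 := sum_le_sum fun b (_ : b ∈ R.erase a) =>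
        mul_classWeight_le (F b).card
      linarith
    · right
      push Not at h
      have h4 := sum_le_sum fun b (hb : b ∈ R) =>
        mul_classWeight_le_of_le_two (hqR b hb) (h b hb)
      have h5 : ∑ a ∈ R, (((F a).card : ℝ) - 1) / 6 = ((S.card : ℝ) - R.card) / 6 := by
        rw [← sum_div, sum_sub_distrib, ← hcard]
        simp
      rw [sum_sub_distrib, hhalf, h5] at h4
      exact h4
  intro z hz
  set g : V → ℝ := fun v => f v * (2 - (w z v : ℝ)) with hg
  have hg0 : ∀ v, 0 ≤ g v := fun v => mul_nonneg (hf0 v) (H.defect_nonneg z v)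
  have hfle : ∀ v, w z v ≠ 2 → f v ≤ g v := fun v hv => by
    have h1 := H.le_two z v
    have h2 : (w z v : ℝ) ≤ 1 := by exact_mod_cast (show w z v ≤ 1 by omega)
    have h3 := hf0 v
    simp only [hg]
    nlinarith
  have hgreen : ∀ v, w z v = 0 → g v = 2 * f v := fun v hv => by
    simp only [hg, hv]
    push_cast
    ring
  have hclass : ∀ v ∈ S, w z v = 1 → ∀ u ∈ F (ρ v), w z u ≠ 2 := by
    intro v hv h u hu h2
    obtain ⟨huS, hu⟩ := mem_filter.1 hu
    have huv : v ≠ u := fun huv => by rw [huv, h2] at h; omega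
    exact H.not_red_of_blue (hsame v hv u huS huv hu.symm) h h2
  have hFS : ∀ a, F a ⊆ S := fun a => filter_subset _ _
  have hFf : ∀ v, ∑ u ∈ F (ρ v), f u = (F (ρ v)).card * classWeight (F (ρ v)).card := by
    intro v
    rw [← nsmul_eq_mul, ← sum_const]
    refine sum_congr rfl fun u hu => ?_
    simp only [hf, (mem_filter.1 hu).2]
  have hblue : ∀ v ∈ S, w z v = 1 → 1 ≤ ∑ u ∈ F (ρ v), g u := by
    intro v hv h
    refine (one_le_mul_classWeight (hq1 v hv)).trans ?_
    rw [← hFf]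
    exact sum_le_sum fun u hu => hfle u (hclass v hv h u hu)
  by_cases hge : ∃ e ∈ S, w z e = 0
  · right; right
    obtain ⟨e, he, hze⟩ := hge
    have hge := hgreen e hze
    have hsplit := add_sum_erase S g he
    have hfe := hf2 e
    have hothers : ∀ v ∈ S.erase e, w z v = 2 := by
      intro v hv
      by_contra hne
      obtain ⟨hve, hvS⟩ := mem_erase.1 hv
      have hle := single_le_sum (fun u _ => hg0 u) hv
      rcases H.weight_cases z v with h | h | h
      · have h1 := hgreen v h
        have h2 := hf2 v
        linarith
      · by_cases hc : ρ v = ρ e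
        · have h1 : ∑ u ∈ F (ρ v), g u ≤ ∑ u ∈ S, g u :=
            sum_le_sum_of_subset_of_nonneg (hFS _) fun u _ _ => hg0 u
          have heF : e ∈ F (ρ v) := by rw [hc]; exact hself e he
          rw [← add_sum_erase _ _ heF] at h1
          have h2 : ∑ u ∈ (F (ρ v)).erase e, f u ≤ ∑ u ∈ (F (ρ v)).erase e, g u :=
            sum_le_sum fun u hu => hfle u (hclass v hvS h u (mem_of_mem_erase hu))
          have h3 := add_sum_erase _ f heF
          rw [hFf v] at h3
          have h4 := two_le_mul_classWeight (hq1 v hvS)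
          have h5 : f e = classWeight (F (ρ v)).card := by simp only [hf, hc]
          linarith
        · have h1 := hblue v hvS h
          have h2 : ∑ u ∈ F (ρ v), g u ≤ ∑ u ∈ S.erase e, g u := by
            refine sum_le_sum_of_subset_of_nonneg (fun u hu => ?_) fun u _ _ => hg0 u
            refine mem_erase.2 ⟨fun hue => hc ?_, hFS _ hu⟩
            rw [← (mem_filter.1 hu).2, hue]
          linarith
      · exact hne h
    have hrest : 0 ≤ ∑ u ∈ S.erase e, g u := sum_nonneg fun u _ => hg0 u
    refine ⟨by linarith, e, he, hze, hothers,
      fun u hu v hv => hS u (mem_of_mem_erase hu) v (mem_of_mem_erase hv), ?_⟩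
    have hcS := card_erase_of_mem he
    have hS1 : 1 ≤ S.card := card_pos.2 ⟨e, he⟩
    by_cases heR : e ∈ R
    · have hq : (F (ρ e)).card ≠ 1 := by
        intro hq
        have : f e = 1 := by simp [hf, hq, classWeight]
        linarith
      obtain ⟨u, hu, hue⟩ := exists_mem_ne (show 1 < (F (ρ e)).card by
        have := hq1 e he; omega) e
      obtain ⟨huS, hρu⟩ := mem_filter.1 hu
      rw [hfix e heR] at hρu
      have huR : u ∉ R := fun h => hue (by rw [← hfix u h, hρu])
      refine ⟨insert u (R.erase e), insert_subset (mem_erase.2 ⟨hue, huS⟩)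
        (erase_subset_erase _ hRS), H.redClique_insert
        (fun a ha b hb => hR a (mem_of_mem_erase ha) b (mem_of_mem_erase hb)) ?_, ?_⟩
      · intro b hb
        obtain ⟨hbe, hb⟩ := mem_erase.1 hb
        refine hdiff u huS b (hRS hb) ?_
        rw [hρu, hfix b hb]
        exact hbe.symm
      · rw [card_insert_of_notMem fun h => huR (mem_of_mem_erase h), card_erase_of_mem heR]
        have : 1 ≤ R.card := card_pos.2 ⟨e, heR⟩
        omega
    · refine ⟨R, fun u hu => mem_erase.2 ⟨fun h => heR (h ▸ hu), hRS hu⟩, hR, ?_⟩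
      omega
  · push Not at hge
    by_cases hb : ∃ a ∈ S, w z a = 1
    · right; left
      obtain ⟨a, ha, hb⟩ := hb
      refine ⟨(hblue a ha hb).trans
        (sum_le_sum_of_subset_of_nonneg (hFS _) fun u _ _ => hg0 u), ⟨a, ha, hb⟩, fun v hv => ?_⟩
      have := hge v hv
      omega
    · left
      push Not at hb
      intro v hv
      have h1 := hge v hv
      have h2 := hb v hv
      have h3 := H.le_two z v
      omega

lemma forall_mem_insert_red (H : DenseFree w r) {S : Finset V} {x z : V} (hz : w z x = 2)
    (h : ∀ v ∈ S, w x v = 2) : ∀ v ∈ insert z S, w x v = 2 := by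
  intro v hv
  rcases mem_insert.1 hv with rfl | hv
  · rw [H.symm, hz]
  · exact h v hv

lemma redBetween_insert_right (H : DenseFree w r) {S T : Finset V} {z : V}
    (hz : ∀ v ∈ S, w z v = 2) (h : RedBetween w S T) : RedBetween w S (insert z T) :=
  H.redBetween_comm (RedBetween.insert_left hz (H.redBetween_comm h))

lemma card_insert_star (H : DenseFree w r) {P : Finset V} {x : V} (hx : ∀ v ∈ P, w x v = 1) :
    (insert x P).card = P.card + 1 :=
  card_insert_of_notMem (H.notMem_of_pos fun v hv => (hx v hv).ge)

lemma hasValue_union_star (H : DenseFree w r) {S P : Finset V} {x : V} {m : ℕ}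
    (hS : HasValue w S m) (hP : BlueClique w P) (hx : ∀ v ∈ P, w x v = 1)
    (hSP : RedBetween w S P) (hSx : ∀ v ∈ S, w x v = 2) :
    HasValue w (S ∪ insert x P) (m + P.card + 2) := by
  have := H.hasValue_union_blue hS (H.blueClique_insert hP hx) (insert_nonempty _ _)
    (H.redBetween_insert_right hSx hSP)
  rw [H.card_insert_star hx] at this
  exact this.mono (by omega)

lemma hasValue_union_star_blue (H : DenseFree w r) {S P T : Finset V} {x : V} {m : ℕ}
    (hS : HasValue w S m) (hP : BlueClique w P) (hx : ∀ v ∈ P, w x v = 1)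
    (hSP : RedBetween w S P) (hSx : ∀ v ∈ S, w x v = 2) (hT : BlueClique w T)
    (hne : T.Nonempty) (hST : RedBetween w S T) (hPT : RedBetween w P T)
    (hxT : ∀ v ∈ T, w x v = 2) :
    HasValue w (S ∪ insert x P ∪ T) (m + P.card + T.card + 3) := by
  have := H.hasValue_union_two_blue hS (H.blueClique_insert hP hx) (insert_nonempty _ _)
    (H.redBetween_insert_right hSx hSP) hT hne hST (RedBetween.insert_left hxT hPT)
  rw [H.card_insert_star hx] at this
  exact this.mono (by omega)

lemma value_add_star_lt (H : DenseFree w r) {S P : Finset V} {x : V} {m : ℕ}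
    (hS : HasValue w S m) (hP : BlueClique w P) (hx : ∀ v ∈ P, w x v = 1)
    (hSP : RedBetween w S P) (hSx : ∀ v ∈ S, w x v = 2) : m + P.card + 2 < 2 * r := by
  by_contra! h
  exact H.free _ ((H.hasValue_union_star hS hP hx hSP hSx).mono h)

lemma value_add_star_blue_lt (H : DenseFree w r) {S P T : Finset V} {x : V} {m : ℕ}
    (hS : HasValue w S m) (hP : BlueClique w P) (hx : ∀ v ∈ P, w x v = 1)
    (hSP : RedBetween w S P) (hSx : ∀ v ∈ S, w x v = 2) (hT : BlueClique w T)
    (hne : T.Nonempty) (hST : RedBetween w S T) (hPT : RedBetween w P T)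
    (hxT : ∀ v ∈ T, w x v = 2) : m + P.card + T.card + 3 < 2 * r := by
  by_contra! h
  exact H.free _ ((H.hasValue_union_star_blue hS hP hx hSP hSx hT hne hST hPT hxT).mono h)

lemma value_add_star_pos_lt (H : DenseFree w r) {S P : Finset V} {x z : V} {m : ℕ}
    (hS : HasValue w S m) (hP : BlueClique w P) (hx : ∀ v ∈ P, w x v = 1)
    (hSP : RedBetween w S P) (hSx : ∀ v ∈ S, w x v = 2) (hzS : ∀ v ∈ S, 1 ≤ w z v)
    (hzP : ∀ v ∈ P, 1 ≤ w z v) (hzx : 1 ≤ w z x) : m + P.card + 3 < 2 * r := by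
  by_contra! h
  refine H.free _ ((H.hasValue_insert_pos (z := z)
    (H.hasValue_union_star hS hP hx hSP hSx) ?_).mono h)
  simp only [mem_union, mem_insert]
  rintro v (hv | rfl | hv)
  exacts [hzS v hv, hzx, hzP v hv]

lemma value_add_star_blue_pos_lt (H : DenseFree w r) {S P T : Finset V} {x z : V} {m : ℕ}
    (hS : HasValue w S m) (hP : BlueClique w P) (hx : ∀ v ∈ P, w x v = 1)
    (hSP : RedBetween w S P) (hSx : ∀ v ∈ S, w x v = 2) (hT : BlueClique w T)
    (hne : T.Nonempty) (hST : RedBetween w S T) (hPT : RedBetween w P T)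
    (hxT : ∀ v ∈ T, w x v = 2) (hzS : ∀ v ∈ S, 1 ≤ w z v)
    (hzP : ∀ v ∈ P, 1 ≤ w z v) (hzx : 1 ≤ w z x) (hzT : ∀ v ∈ T, 1 ≤ w z v) :
    m + P.card + T.card + 4 < 2 * r := by
  by_contra! h
  refine H.free _ ((H.hasValue_insert_pos (z := z)
    (H.hasValue_union_star_blue hS hP hx hSP hSx hT hne hST hPT hxT) ?_).mono h)
  simp only [mem_union, mem_insert]
  rintro v ((hv | rfl | hv) | hv)
  exacts [hzS v hv, hzx, hzP v hv, hzT v hv]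

/-- The end vertices of an edge of weight `0` are blue to all of `P` and red to all of `E`. -/
lemma secure_of_common_blue (H : DenseFree w r) {x y : V} : ∀ (p : ℕ) (E P : Finset V) (m : ℕ),
    P.card = p → BlueClique w P → (∀ v ∈ P, w x v = 1) → (∀ v ∈ P, w y v = 1) →
    (∀ v ∈ E, w x v = 2) → (∀ v ∈ E, w y v = 2) → RedBetween w E P → HasValue w E m →
    2 * r ≤ m + p + 3 → Secure w r x y := by
  intro p
  induction p using Nat.strong_induction_on with
  | _ p ih =>
  intro E P m hp hP hxP hyP hxE hyE hEP hE hm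
  have hr := H.three_le
  obtain ⟨R, hRE, hR, hmax, f, hf, hsum, htri⟩ := H.exists_weights hE.1
  by_cases hk : r ≤ R.card + 2
  · exact H.secure_of_redClique hR (fun v hv => hxE v (hRE hv)) (fun v hv => hyE v (hRE hv)) hk
  have hE' : HasValue w E (R.card + E.card) := ⟨hE.1, R, hRE, hR, le_rfl⟩
  have hRcard := card_le_card hRE
  obtain ⟨_, R₀, hR₀, hR₀', hm₀⟩ := hE
  have hRR := hmax R₀ hR₀ hR₀'
  have hexact := H.value_add_star_lt hE' hP hxP hEP hxE
  have hme : R.card + E.card + p + 3 = 2 * r := by omega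
  have hmeR : (R.card : ℝ) + E.card + p + 3 = 2 * r := by exact_mod_cast hme
  obtain ⟨γ, hγ, hγ1, ht⟩ : ∃ γ : ℝ, 3 / 7 ≤ γ ∧ (p ≤ 1 → 1 / 2 ≤ γ) ∧
      ∑ v ∈ E, f v + γ * P.card + 0 * (∅ : Finset V).card + 1 / 2 + 1 / 2 ≤ r - 5 / 7 := by
    have hdiff : ∀ d : ℕ, R.card + d ≤ E.card → (d : ℝ) ≤ (E.card : ℝ) - R.card := by
      intro d hd
      have : (R.card : ℝ) + d ≤ E.card := by exact_mod_cast hd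
      linarith
    rw [hp]
    by_cases h1 : p ≤ 1
    · refine ⟨1 / 2, by norm_num, fun _ => le_rfl, ?_⟩
      have := hdiff 2 (by omega)
      push_cast at this ⊢
      rcases hsum with hsum | hsum <;> linarith
    · refine ⟨3 / 7, le_rfl, fun h => absurd h h1, ?_⟩
      by_cases h2 : p = 2
      · have := hdiff 1 (by omega)
        subst h2
        push_cast at this hmeR ⊢
        rcases hsum with hsum | hsum <;> linarith
      · have := hdiff 0 (by omega)
        have h3 : (3 : ℝ) ≤ p := by exact_mod_cast (show 3 ≤ p by omega)
        push_cast at this ⊢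
        rcases hsum with hsum | hsum <;> linarith
  obtain ⟨z, hz⟩ := H.exists_small_defect E P ∅ x y f γ 0 (1 / 2) (1 / 2) hf (by linarith) le_rfl
    (by norm_num) (by norm_num) ht
  have hD0 : 0 ≤ ∑ v ∈ E, f v * (2 - (w z v : ℝ)) :=
    sum_nonneg fun v _ => mul_nonneg (hf v) (H.defect_nonneg z v)
  specialize htri z
  set D := ∑ v ∈ E, f v * (2 - (w z v : ℝ)) with hD
  have hd0 := H.defect_sum_nonneg z P
  have hx0 := H.defect_nonneg z x
  have hy0 := H.defect_nonneg z y
  have hγd := mul_le_mul_of_nonneg_right hγ hd0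
  have hγd1 : p ≤ 1 → _ := fun h => mul_le_mul_of_nonneg_right (hγ1 h) hd0
  replace htri := htri (by linarith)
  have hone : ¬ (w z x ≠ 2 ∧ w z y ≠ 2) → w z x = 2 ∨ w z y = 2 := by tauto
  by_cases hg : ∃ a ∈ P, w z a = 0
  · obtain ⟨a, ha, hza⟩ := hg
    have hPa : BlueClique w (P.erase a) :=
      fun u hu v hv => hP u (mem_of_mem_erase hu) v (mem_of_mem_erase hv)
    have hca := card_erase_of_mem ha
    have hp1 : 1 ≤ P.card := card_pos.2 ⟨a, ha⟩
    have hda := H.le_defect_sum z ha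
    have h2a := H.two_le_defect hza
    have hEPa : RedBetween w E (P.erase a) := fun u hu v hv => hEP u hu v (mem_of_mem_erase hv)
    by_cases hg' : ∃ b ∈ P.erase a, w z b = 0
    · obtain ⟨b, hb, hzb⟩ := hg'
      have hdb := H.le_defect_sum_pair z ha hb
      have h2b := H.two_le_defect hzb
      have hcb := card_erase_of_mem hb
      have hcb1 : 1 ≤ (P.erase a).card := card_pos.2 ⟨b, hb⟩
      have hzx : w z x = 2 := by
        by_contra h
        have := H.one_le_defect h
        linarith
      have hzy : w z y = 2 := by
        by_contra h
        have := H.one_le_defect h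
        linarith
      have hzP : ∀ v ∈ (P.erase a).erase b, w z v = 2 := by
        intro v hv
        by_contra h
        have := H.one_le_defect h
        have := H.le_defect_sum_triple z ha hb hv
        linarith
      have hzE : ∀ v ∈ E, w z v = 2 := by
        rcases htri with h | ⟨h, -⟩ | ⟨h, -⟩
        · exact h
        · linarith
        · linarith
      exact ih (p - 2) (by omega) (insert z E) ((P.erase a).erase b) (R.card + E.card + 2)
        (by omega) (fun u hu v hv => hPa u (mem_of_mem_erase hu) v (mem_of_mem_erase hv))
        (fun v hv => hxP v (mem_of_mem_erase (mem_of_mem_erase hv)))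
        (fun v hv => hyP v (mem_of_mem_erase (mem_of_mem_erase hv)))
        (H.forall_mem_insert_red hzx hxE) (H.forall_mem_insert_red hzy hyE)
        (RedBetween.insert_left hzP fun u hu v hv => hEPa u hu v (mem_of_mem_erase hv))
        (H.hasValue_insert_red hE' hzE) (by omega)
    · push Not at hg'
      have hlarge : 1 ≤ D → w z x = 2 ∧ w z y = 2 ∧ ∀ v ∈ P.erase a, w z v = 2 := by
        intro h
        refine ⟨?_, ?_, ?_⟩
        · by_contra h
          have := H.one_le_defect h
          linarith
        · by_contra h
          have := H.one_le_defect h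
          linarith
        · intro v hv
          by_contra h
          have := H.one_le_defect h
          have := H.le_defect_sum_pair z ha hv
          linarith
      have hstep : ∀ E' ⊆ E, 1 ≤ D → HasValue w (insert z E') (R.card + E.card + 1) →
          Secure w r x y := by
        intro E' hE'E h hval
        obtain ⟨hzx, hzy, hzP⟩ := hlarge h
        exact ih (p - 1) (by omega) (insert z E') (P.erase a) (R.card + E.card + 1)
          (by omega) hPa (fun v hv => hxP v (mem_of_mem_erase hv))
          (fun v hv => hyP v (mem_of_mem_erase hv))
          (H.forall_mem_insert_red hzx fun v hv => hxE v (hE'E hv))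
          (H.forall_mem_insert_red hzy fun v hv => hyE v (hE'E hv))
          (RedBetween.insert_left hzP fun u hu v hv => hEPa u (hE'E hu) v hv)
          hval (by omega)
      rcases htri with hzE | ⟨h, -, hzE⟩ | ⟨h, e, he, -, hzE, hval⟩
      · exfalso
        have hred : ∀ t, (∀ v ∈ P, w t v = 1) → (∀ v ∈ E, w t v = 2) → w z t = 2 → False := by
          intro t htP htE hzt
          have hzP : ∀ v ∈ P.erase a, w z v = 2 := by
            intro v hv
            have h1 := hg' v hv
            have h2 := H.not_blue_of_red (htP v (mem_of_mem_erase hv)) hzt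
            have h3 := H.le_two z v
            omega
          have := H.value_add_star_lt (H.hasValue_insert_red hE' hzE) hPa
            (fun v hv => htP v (mem_of_mem_erase hv)) (RedBetween.insert_left hzP hEPa)
            (H.forall_mem_insert_red hzt htE)
          omega
        rcases hone (by
          rintro ⟨h1, h2⟩
          have h3 := H.one_le_defect h1
          have h4 := H.one_le_defect h2
          by_cases hp2 : p ≤ 1
          · have := hγd1 hp2
            linarith
          · obtain ⟨b, hb⟩ : (P.erase a).Nonempty := card_pos.1 (by omega)
            have hdb := H.le_defect_sum_pair z ha hb
            by_cases hzb : w z b = 2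
            · have h5 := H.not_blue_of_red (by rw [H.symm, hxP b (mem_of_mem_erase hb)]) hzb
              have h6 := H.not_blue_of_red (by rw [H.symm, hyP b (mem_of_mem_erase hb)]) hzb
              have h7 := H.two_le_defect (z := z) (v := x) (by have := H.le_two z x; omega)
              have h8 := H.two_le_defect (z := z) (v := y) (by have := H.le_two z y; omega)
              linarith
            · have := H.one_le_defect hzb
              linarith) with h | h
        · exact hred x hxP hxE h
        · exact hred y hyP hyE h
      · exact hstep E Subset.rfl h (H.hasValue_insert_pos hE' hzE)
      · exact hstep _ (erase_subset _ _) h ((H.hasValue_insert_red hval hzE).mono (by omega))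
  · exfalso
    push Not at hg
    have hpos : ∀ v ∈ P, 1 ≤ w z v := fun v hv => Nat.one_le_iff_ne_zero.2 (hg v hv)
    have hpos' : (∀ v ∈ E, 1 ≤ w z v) → False := by
      intro hzE
      have hgr : ∀ t, (∀ v ∈ P, w t v = 1) → (∀ v ∈ E, w t v = 2) → w z t = 0 := by
        intro t htP htE
        by_contra h
        have := H.value_add_star_pos_lt hE' hP htP hEP htE hzE hpos (by omega)
        omega
      have h1 := H.two_le_defect (hgr x hxP hxE)
      have h2 := H.two_le_defect (hgr y hyP hyE)
      linarith
    rcases htri with hzE | ⟨h, -, hzE⟩ | ⟨h, e, he, -, hzE, hval⟩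
    · exact hpos' fun v hv => by rw [hzE v hv]; omega
    · exact hpos' hzE
    · have hred : ∀ t, (∀ v ∈ P, w t v = 1) → (∀ v ∈ E, w t v = 2) → w z t = 2 → False := by
        intro t htP htE hzt
        have hzP : ∀ v ∈ P, w z v = 2 := by
          intro v hv
          have h1 := hg v hv
          have h2 := H.not_blue_of_red (htP v hv) hzt
          have h3 := H.le_two z v
          omega
        have := H.value_add_star_lt (H.hasValue_insert_red hval hzE) hP htP
          (RedBetween.insert_left hzP fun u hu v hv => hEP u (mem_of_mem_erase hu) v hv)
          (H.forall_mem_insert_red hzt fun v hv => htE v (mem_of_mem_erase hv))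
        omega
      rcases hone (by
        rintro ⟨h1, h2⟩
        have h3 := H.one_le_defect h1
        have h4 := H.one_le_defect h2
        linarith) with h | h
      · exact hred x hxP hxE h
      · exact hred y hyP hyE h

lemma BluePairs.value_lt (H : DenseFree w r) {x y : V} {E P Q : Finset V} {m : ℕ}
    (h : BluePairs w x y E P Q) (hE : HasValue w E m) (hQ : Q.Nonempty) :
    m + P.card + Q.card + 3 < 2 * r :=
  H.value_add_star_blue_lt hE h.bluep h.bluex h.redp h.redx h.blueq hQ h.redq h.redpq h.redxq

lemma BluePairs.value_lt_of_red (H : DenseFree w r) {x y z : V} {E P Q : Finset V} {m : ℕ}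
    (h : BluePairs w x y E P Q) (hE : HasValue w E m) (hQ : Q.Nonempty)
    (hzE : ∀ v ∈ E, w z v = 2) (hzP : ∀ v ∈ P, w z v = 2) (hzQ : ∀ v ∈ Q, w z v = 2)
    (hzx : w z x = 2) : m + P.card + Q.card + 5 < 2 * r := by
  have := H.value_add_star_blue_lt (H.hasValue_insert_red hE hzE) h.bluep h.bluex
    (h.redp.insert_left hzP) (H.forall_mem_insert_red hzx h.redx) h.blueq hQ
    (h.redq.insert_left hzQ) h.redpq h.redxq
  omega

lemma BluePairs.value_lt_of_pos (H : DenseFree w r) {x y z : V} {E P Q : Finset V} {m : ℕ}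
    (h : BluePairs w x y E P Q) (hE : HasValue w E m) (hQ : Q.Nonempty)
    (hzE : ∀ v ∈ E, 1 ≤ w z v) (hzP : ∀ v ∈ P, w z v ≠ 0) (hzQ : ∀ v ∈ Q, w z v ≠ 0)
    (hzx : w z x ≠ 0) : m + P.card + Q.card + 4 < 2 * r :=
  H.value_add_star_blue_pos_lt hE h.bluep h.bluex h.redp h.redx h.blueq hQ h.redq h.redpq
    h.redxq hzE (fun v hv => Nat.one_le_iff_ne_zero.2 (hzP v hv)) (Nat.one_le_iff_ne_zero.2 hzx)
    fun v hv => Nat.one_le_iff_ne_zero.2 (hzQ v hv)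

lemma BluePairs.false_of_green (H : DenseFree w r) {x y z a : V} {E P Q : Finset V} {m : ℕ}
    {γ β κ η : ℝ} (h : BluePairs w x y E P Q) (hE : HasValue w E m) (hQ : Q.Nonempty)
    (hm : 2 * r ≤ m + P.card + Q.card + 4)
    (hp : (P.card = 1 ∧ γ = 6 / 7 ∧ β = 2 / 7) ∨ (2 ≤ P.card ∧ γ = 1 / 2 ∧ β = 1 / 2))
    (hq : (Q.card = 1 ∧ κ = 6 / 7 ∧ η = 2 / 7) ∨ (2 ≤ Q.card ∧ κ = 1 / 2 ∧ η = 1 / 2))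
    (hz : γ * ∑ v ∈ P, (2 - (w z v : ℝ)) + κ * ∑ v ∈ Q, (2 - (w z v : ℝ)) +
      β * (2 - (w z x : ℝ)) + η * (2 - (w z y : ℝ)) < 2)
    (hzE : ∀ v ∈ E, w z v = 2) (ha : a ∈ P) (hza : w z a = 0) : False := by
  have hc := card_erase_of_mem ha
  have hp1 : 1 ≤ P.card := card_pos.2 ⟨a, ha⟩
  have hdP := H.le_defect_sum z ha
  have hda := H.two_le_defect hza
  have hdQ := H.defect_sum_nonneg z Q
  have hx0 := H.defect_nonneg z x
  have hy0 := H.defect_nonneg z y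
  have hQred : ∀ v ∈ Q, w z v = 2 := by
    intro v hv
    have hdv := H.le_defect_sum z hv
    rcases H.weight_cases z v with hzv | hzv | hzv
    · have := H.two_le_defect hzv
      rcases hp with ⟨-, rfl, rfl⟩ | ⟨-, rfl, rfl⟩ <;>
        rcases hq with ⟨-, rfl, rfl⟩ | ⟨-, rfl, rfl⟩ <;> linarith
    · have h1 : w z y ≠ 2 := H.not_red_of_blue (by rw [H.symm, h.bluey v hv]) hzv
      have := H.one_le_defect h1
      have := H.one_le_defect (z := z) (v := v) (by omega)
      rcases hp with ⟨-, rfl, rfl⟩ | ⟨-, rfl, rfl⟩ <;>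
        rcases hq with ⟨-, rfl, rfl⟩ | ⟨-, rfl, rfl⟩ <;> linarith
    · exact hzv
  have hPred : ∀ v ∈ P.erase a, w z v = 2 := by
    intro v hv
    have hdv := H.le_defect_sum_pair z ha hv
    have hcv : 1 ≤ (P.erase a).card := card_pos.2 ⟨v, hv⟩
    rcases H.weight_cases z v with hzv | hzv | hzv
    · have := H.two_le_defect hzv
      rcases hp with ⟨-, rfl, rfl⟩ | ⟨-, rfl, rfl⟩ <;>
        rcases hq with ⟨-, rfl, rfl⟩ | ⟨-, rfl, rfl⟩ <;> linarith
    · have h1 : w z x ≠ 2 :=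
        H.not_red_of_blue (by rw [H.symm, h.bluex v (mem_of_mem_erase hv)]) hzv
      have := H.one_le_defect h1
      have := H.one_le_defect (z := z) (v := v) (by omega)
      rcases hp with ⟨hp, -⟩ | ⟨-, rfl, rfl⟩
      · omega
      · rcases hq with ⟨-, rfl, rfl⟩ | ⟨-, rfl, rfl⟩ <;> linarith
    · exact hzv
  rcases H.weight_cases z x with hzx | hzx | hzx
  · have := H.two_le_defect hzx
    rcases hp with ⟨-, rfl, rfl⟩ | ⟨-, rfl, rfl⟩ <;>
      rcases hq with ⟨-, rfl, rfl⟩ | ⟨-, rfl, rfl⟩ <;> linarith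
  · rcases hp with ⟨hp, rfl, rfl⟩ | ⟨hp, -⟩
    · have := H.one_le_defect (z := z) (v := x) (by omega)
      rcases hq with ⟨-, rfl, rfl⟩ | ⟨-, rfl, rfl⟩ <;> linarith
    · obtain ⟨v, hv⟩ : (P.erase a).Nonempty := card_pos.1 (by omega)
      exact H.not_blue_of_red (by rw [H.symm, h.bluex v (mem_of_mem_erase hv)]) (hPred v hv) hzx
  · have := (h.mono Subset.rfl (erase_subset a P) Subset.rfl).value_lt_of_red H hE hQ hzE
      hPred hQred hzx
    omega

lemma exists_side_weights {p : ℕ} (hp : 1 ≤ p) : ∃ γ β : ℝ,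
    ((p = 1 ∧ γ = 6 / 7 ∧ β = 2 / 7) ∨ (2 ≤ p ∧ γ = 1 / 2 ∧ β = 1 / 2)) ∧
      γ * p + β ≤ p / 2 + 9 / 14 := by
  by_cases h : p = 1
  · refine ⟨6 / 7, 2 / 7, Or.inl ⟨h, rfl, rfl⟩, ?_⟩
    subst h
    norm_num
  · refine ⟨1 / 2, 1 / 2, Or.inr ⟨by omega, rfl, rfl⟩, ?_⟩
    linarith

lemma BluePairs.false_of_nonempty (H : DenseFree w r) {x y : V} {E P Q : Finset V} {m : ℕ}
    (h : BluePairs w x y E P Q) (hE : HasValue w E m) (hP : P.Nonempty) (hQ : Q.Nonempty)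
    (hm : 2 * r ≤ m + P.card + Q.card + 4) : False := by
  obtain ⟨R, hRE, hR, hmax, f, hf, hsum, htri⟩ := H.exists_weights hE.1
  have hE' : HasValue w E (R.card + E.card) := ⟨hE.1, R, hRE, hR, le_rfl⟩
  have hRcard := card_le_card hRE
  obtain ⟨_, R₀, hR₀, hR₀', hm₀⟩ := hE
  have hRR := hmax R₀ hR₀ hR₀'
  have hexact := h.value_lt H hE' hQ
  have hme : R.card + E.card + P.card + Q.card + 4 = 2 * r := by omega
  have hmeR : (R.card : ℝ) + E.card + P.card + Q.card + 4 = 2 * r := by exact_mod_cast hme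
  have hRcardR : (R.card : ℝ) ≤ E.card := by exact_mod_cast hRcard
  obtain ⟨γ, β, hp, hpt⟩ := exists_side_weights (card_pos.2 hP)
  obtain ⟨κ, η, hq, hqt⟩ := exists_side_weights (card_pos.2 hQ)
  have hpos : 1 / 2 ≤ γ ∧ 2 / 7 ≤ β ∧ 1 ≤ γ + β ∧ 1 / 2 ≤ κ ∧ 2 / 7 ≤ η ∧ 1 ≤ κ + η ∧
      2 ≤ γ + 2 * β + 2 * η ∧ 2 ≤ κ + 2 * β + 2 * η := by
    rcases hp with ⟨-, rfl, rfl⟩ | ⟨-, rfl, rfl⟩ <;>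
      rcases hq with ⟨-, rfl, rfl⟩ | ⟨-, rfl, rfl⟩ <;> norm_num
  obtain ⟨hγ, hβ, hγβ, hκ, hη, hκη, hγη, hκβ⟩ := hpos
  have hγ0 : 0 ≤ γ := by linarith only [hγ]
  have hκ0 : 0 ≤ κ := by linarith only [hκ]
  have hβ0 : 0 ≤ β := by linarith only [hβ]
  have hη0 : 0 ≤ η := by linarith only [hη]
  obtain ⟨z, hz⟩ := H.exists_small_defect E P Q x y f γ κ β η hf hγ0 hκ0
    (by linarith only [hβ]) hη0 (by rcases hsum with hsum | hsum <;> linarith)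
  have hD0 : 0 ≤ ∑ v ∈ E, f v * (2 - (w z v : ℝ)) :=
    sum_nonneg fun v _ => mul_nonneg (hf v) (H.defect_nonneg z v)
  specialize htri z
  set D := ∑ v ∈ E, f v * (2 - (w z v : ℝ)) with hD
  have hdP := H.defect_sum_nonneg z P
  have hdQ := H.defect_sum_nonneg z Q
  have hx0 := H.defect_nonneg z x
  have hy0 := H.defect_nonneg z y
  have hγd := mul_nonneg hγ0 hdP
  have hκd := mul_nonneg hκ0 hdQ
  have hβx := mul_nonneg hβ0 hx0
  have hηy := mul_nonneg hη0 hy0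
  replace htri := htri (by linarith)
  have hgr : w z x = 0 → w z y = 0 →
      2 * β + 2 * η ≤ β * (2 - (w z x : ℝ)) + η * (2 - (w z y : ℝ)) := by
    intro hzx hzy
    simp only [hzx, hzy, Nat.cast_zero]
    linarith only
  have hPgreen : (1 ≤ D ∨ ∀ v ∈ E, w z v = 2) → ∀ v ∈ P, w z v ≠ 0 := by
    rintro (h1 | hzE) v hv hzv
    · have := mul_le_mul hγ ((H.two_le_defect hzv).trans (H.le_defect_sum z hv)) (by norm_num)
        (by linarith only [hγ])
      linarith
    · exact h.false_of_green H hE' hQ hme.ge hp hq (by linarith) hzE hv hzv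
  have hQgreen : (1 ≤ D ∨ ∀ v ∈ E, w z v = 2) → ∀ v ∈ Q, w z v ≠ 0 := by
    rintro (h1 | hzE) v hv hzv
    · have := mul_le_mul hκ ((H.two_le_defect hzv).trans (H.le_defect_sum z hv)) (by norm_num)
        (by linarith only [hκ])
      linarith
    · exact (h.swap H).false_of_green H hE' hP (by omega) hq hp (by linarith) hzE hv hzv
  have hdef : ∀ {S : Finset V} {c : ℝ} {v : V}, 0 ≤ c → v ∈ S → w z v ≠ 2 →
      c ≤ c * ∑ v ∈ S, (2 - (w z v : ℝ)) := by
    intro S c v hc hv hzv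
    exact le_mul_of_one_le_right hc ((H.one_le_defect hzv).trans (H.le_defect_sum z hv))
  have hdef' : ∀ {c : ℝ} {v : V}, 0 ≤ c → w z v ≠ 2 → c ≤ c * (2 - (w z v : ℝ)) := by
    intro c v hc hzv
    exact le_mul_of_one_le_right hc (H.one_le_defect hzv)
  have hsplit : (∀ v ∈ E, 1 ≤ w z v) → (∀ v ∈ P, w z v ≠ 0) → (∀ v ∈ Q, w z v ≠ 0) →
      2 * β + 2 * η ≤ β * (2 - (w z x : ℝ)) + η * (2 - (w z y : ℝ)) ∧ w z x = 0 ∧ w z y = 0 := by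
    intro hzE hzP hzQ
    have hzx : w z x = 0 := by
      by_contra hzx
      have := h.value_lt_of_pos H hE' hQ hzE hzP hzQ hzx
      omega
    have hzy : w z y = 0 := by
      by_contra hzy
      have := (h.swap H).value_lt_of_pos H hE' hP hzE hzQ hzP hzy
      omega
    exact ⟨hgr hzx hzy, hzx, hzy⟩
  rcases htri with hzE | ⟨h1, -, hzE⟩ | ⟨h1, e, he, -, hzE, hval⟩
  · have hzP := hPgreen (Or.inr hzE)
    have hzQ := hQgreen (Or.inr hzE)
    obtain ⟨h8, hzx, hzy⟩ := hsplit (fun v hv => by rw [hzE v hv]; omega) hzP hzQ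
    have hzP' : ∀ v ∈ P, w z v = 2 := by
      intro v hv
      by_contra hzv
      have := hdef hγ0 hv hzv
      linarith
    have hzQ' : ∀ v ∈ Q, w z v = 2 := by
      intro v hv
      by_contra hzv
      have := hdef hκ0 hv hzv
      linarith
    have := H.value_add_two_blue_lt (H.hasValue_insert_red hE' hzE) h.bluep hP
      (h.redp.insert_left hzP') h.blueq hQ (h.redq.insert_left hzQ') h.redpq
    omega
  · obtain ⟨h8, -⟩ := hsplit hzE (hPgreen (Or.inl h1)) (hQgreen (Or.inl h1))
    linarith
  · have hzP : ∀ v ∈ P, w z v = 2 := by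
      intro v hv
      by_contra hzv
      have h2 := hPgreen (Or.inl h1) v hv
      have h3 : w z v = 1 := by have := H.le_two z v; omega
      have h4 := hdef hγ0 hv hzv
      have h5 := hdef' hβ0
        (H.not_red_of_blue (v := x) (by rw [H.symm, h.bluex v hv]) h3)
      linarith
    have hzQ : ∀ v ∈ Q, w z v = 2 := by
      intro v hv
      by_contra hzv
      have h2 := hQgreen (Or.inl h1) v hv
      have h3 : w z v = 1 := by have := H.le_two z v; omega
      have h4 := hdef hκ0 hv hzv
      have h5 := hdef' hη0
        (H.not_red_of_blue (v := y) (by rw [H.symm, h.bluey v hv]) h3)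
      linarith
    obtain ⟨u, hu⟩ := hP
    obtain ⟨v, hv⟩ := hQ
    have hzx := H.not_blue_of_red (v := x) (by rw [H.symm, h.bluex u hu]) (hzP u hu)
    have hzy := H.not_blue_of_red (v := y) (by rw [H.symm, h.bluey v hv]) (hzQ v hv)
    have h' := h.mono (erase_subset e E) Subset.rfl Subset.rfl
    rcases H.weight_cases z x with hx | hx | hx
    · rcases H.weight_cases z y with hy | hy | hy
      · have := hgr hx hy
        linarith
      · exact hzy hy
      · have := (h'.swap H).value_lt_of_red H hval ⟨u, hu⟩ hzE hzQ hzP hy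
        omega
    · exact hzx hx
    · have := h'.value_lt_of_red H hval ⟨v, hv⟩ hzE hzP hzQ hx
      omega

lemma secure_of_common_red (H : DenseFree w r) {x y : V} {E : Finset V} {m : ℕ}
    (hx : ∀ v ∈ E, w x v = 2) (hy : ∀ v ∈ E, w y v = 2) (hE : HasValue w E m)
    (hm : 2 * r ≤ m + 3) : Secure w r x y :=
  H.secure_of_common_blue 0 E ∅ m rfl (by simp [BlueClique]) (by simp) (by simp) hx hy
    (by simp [RedBetween]) hE hm

lemma BluePairs.secure_of_right_empty (H : DenseFree w r) {x y : V} {E P : Finset V} {m : ℕ}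
    (h : BluePairs w x y E P ∅) (hE : HasValue w E m) (hP : P.Nonempty)
    (hm : 2 * r ≤ m + P.card + 4) : Secure w r x y := by
  obtain ⟨R, hRE, hR, hmax, f, hf, hsum, htri⟩ := H.exists_weights hE.1
  have hE' : HasValue w E (R.card + E.card) := ⟨hE.1, R, hRE, hR, le_rfl⟩
  have hRcard := card_le_card hRE
  obtain ⟨_, R₀, hR₀, hR₀', hm₀⟩ := hE
  have hRR := hmax R₀ hR₀ hR₀'
  have hexact := (h.swap H).value_lt H hE' hP
  rw [card_empty] at hexact
  have hme : R.card + E.card + P.card + 4 = 2 * r := by omega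
  have hmeR : (R.card : ℝ) + E.card + P.card + 4 = 2 * r := by exact_mod_cast hme
  have hRcardR : (R.card : ℝ) ≤ E.card := by exact_mod_cast hRcard
  have hP1 : 1 ≤ P.card := card_pos.2 hP
  obtain ⟨γ, hγ, hγ1, ht⟩ : ∃ γ : ℝ, 1 / 2 ≤ γ ∧ (P.card = 1 → 3 / 4 ≤ γ) ∧
      γ * P.card ≤ P.card / 2 + 2 / 7 := by
    by_cases h1 : P.card = 1
    · exact ⟨11 / 14, by norm_num, fun _ => by norm_num, by rw [h1]; norm_num⟩
    · exact ⟨1 / 2, le_rfl, fun h => absurd h h1, by linarith⟩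
  have hγ0 : 0 ≤ γ := by linarith only [hγ]
  obtain ⟨z, hz⟩ := H.exists_small_defect E P ∅ x y f γ 0 (1 / 2) (1 / 2) hf hγ0 le_rfl
    (by norm_num) (by norm_num) (by
      rw [card_empty, Nat.cast_zero]
      rcases hsum with hsum | hsum <;> linarith)
  rw [zero_mul, add_zero] at hz
  have hD0 : 0 ≤ ∑ v ∈ E, f v * (2 - (w z v : ℝ)) :=
    sum_nonneg fun v _ => mul_nonneg (hf v) (H.defect_nonneg z v)
  specialize htri z
  set D := ∑ v ∈ E, f v * (2 - (w z v : ℝ)) with hD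
  have hx0 := H.defect_nonneg z x
  have hy0 := H.defect_nonneg z y
  have hγd := mul_nonneg hγ0 (H.defect_sum_nonneg z P)
  replace htri := htri (by linarith)
  have hdef : ∀ {c : ℝ}, c ≤ ∑ v ∈ P, (2 - (w z v : ℝ)) →
      γ * c ≤ γ * ∑ v ∈ P, (2 - (w z v : ℝ)) := fun hc => mul_le_mul_of_nonneg_left hc hγ0
  have hdef1 : ∀ {v}, v ∈ P → w z v ≠ 2 → γ ≤ γ * ∑ v ∈ P, (2 - (w z v : ℝ)) := by
    intro v hv hzv
    have := hdef ((H.one_le_defect hzv).trans (H.le_defect_sum z hv))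
    linarith only [this]
  have hdef2 : ∀ {v}, v ∈ P → w z v = 0 → 2 * γ ≤ γ * ∑ v ∈ P, (2 - (w z v : ℝ)) := by
    intro v hv hzv
    have := hdef ((H.two_le_defect hzv).trans (H.le_defect_sum z hv))
    linarith only [this]
  have hblue : ∀ {v}, v ∈ P → w z v = 1 → 1 ≤ 2 - (w z x : ℝ) := fun hv hzv =>
    H.one_le_defect (H.not_red_of_blue (by rw [H.symm, h.bluex _ hv]) hzv)
  have hxblue : ∀ {v}, v ∈ P → w z v = 2 → w z x ≠ 1 := fun hv hzv =>
    H.not_blue_of_red (by rw [H.symm, h.bluex _ hv]) hzv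
  rcases htri with hzE | ⟨h1, -, hzE⟩ | ⟨h1, e, he, -, hzE, hval⟩
  · by_cases hg : ∃ a ∈ P, w z a = 0
    · obtain ⟨a, ha, hza⟩ := hg
      have hca := card_erase_of_mem ha
      have hda := hdef2 ha hza
      have hzP : ∀ v ∈ P.erase a, w z v = 2 := by
        intro v hv
        have hd := H.le_defect_sum_pair z ha hv
        have h2 := H.two_le_defect hza
        rcases H.weight_cases z v with hzv | hzv | hzv
        · have := hdef ((add_le_add h2 (H.two_le_defect hzv)).trans hd)
          linarith
        · have := hdef ((add_le_add h2 (H.one_le_defect (v := v) (by omega))).trans hd)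
          have := hblue (mem_of_mem_erase hv) hzv
          linarith
        · exact hzv
      have hone : P.card = 1 → ∀ {t}, t = x ∨ t = y → w z t ≠ 2 → False := by
        intro hP1 t ht hzt
        have h3 := hγ1 hP1
        have h4 := H.one_le_defect hzt
        rcases ht with rfl | rfl <;> linarith
      have hzx : w z x = 2 := by
        rcases H.weight_cases z x with hzx | hzx | hzx
        · have := H.two_le_defect hzx
          linarith
        · by_cases hp : P.card = 1
          · exact (hone hp (Or.inl rfl) (by omega)).elim
          · obtain ⟨v, hv⟩ : (P.erase a).Nonempty := card_pos.1 (by omega)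
            exact absurd hzx (hxblue (mem_of_mem_erase hv) (hzP v hv))
        · exact hzx
      have h' := h.mono Subset.rfl (erase_subset a P) Subset.rfl
      by_cases hp : P.card = 1
      · have hzy : w z y = 2 := by
          by_contra hzy
          exact hone hp (Or.inr rfl) hzy
        exact H.secure_of_common_red (H.forall_mem_insert_red hzx h.redx)
          (H.forall_mem_insert_red hzy h.redy) (H.hasValue_insert_red hE' hzE) (by omega)
      · exfalso
        have hne : (P.erase a).Nonempty := card_pos.1 (by omega)
        rcases H.weight_cases z y with hzy | hzy | hzy
        · have := H.two_le_defect hzy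
          linarith
        · refine (h'.singleton H hzE hzP hzx hzy).false_of_nonempty H hE' hne
            (singleton_nonempty z) ?_
          rw [card_singleton]
          omega
        · have := (h'.swap H).value_lt_of_red H hE' hne hzE (by simp) hzP hzy
          rw [card_empty] at this
          omega
    · exfalso
      push Not at hg
      have hzy : w z y = 0 := by
        by_contra hzy
        have := (h.swap H).value_lt_of_pos H hE' hP (fun v hv => by rw [hzE v hv]; omega)
          (by simp) hg hzy
        rw [card_empty] at this
        omega
      have hdy := H.two_le_defect hzy
      have hzP : ∀ v ∈ P, w z v = 2 := by
        intro v hv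
        rcases H.weight_cases z v with hzv | hzv | hzv
        · exact absurd hzv (hg v hv)
        · have := hdef1 hv (by omega)
          have := hblue hv hzv
          linarith
        · exact hzv
      obtain ⟨u, hu⟩ := hP
      rcases H.weight_cases z x with hzx | hzx | hzx
      · have := H.two_le_defect hzx
        linarith
      · exact hxblue hu (hzP u hu) hzx
      · have := H.value_add_star_lt (H.hasValue_insert_red hE' hzE) h.bluep h.bluex
          (h.redp.insert_left hzP) (H.forall_mem_insert_red hzx h.redx)
        omega
  · exfalso
    have := (h.swap H).value_lt_of_pos H hE' hP hzE (by simp)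
      (fun v hv hzv => by
        have := hdef2 hv hzv
        linarith)
      (fun hzy => by
        have := H.two_le_defect hzy
        linarith)
    rw [card_empty] at this
    omega
  · exfalso
    have hzP : ∀ v ∈ P, w z v = 2 := by
      intro v hv
      rcases H.weight_cases z v with hzv | hzv | hzv
      · have := hdef2 hv hzv
        linarith
      · have := hdef1 hv (by omega)
        have := hblue hv hzv
        linarith
      · exact hzv
    have h' := h.mono (erase_subset e E) Subset.rfl Subset.rfl
    have hzx : w z x = 2 := by
      obtain ⟨u, hu⟩ := hP
      rcases H.weight_cases z x with hzx | hzx | hzx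
      · have := H.two_le_defect hzx
        linarith
      · exact absurd hzx (hxblue hu (hzP u hu))
      · exact hzx
    rcases H.weight_cases z y with hzy | hzy | hzy
    · have := H.two_le_defect hzy
      linarith
    · refine (h'.singleton H hzE hzP hzx hzy).false_of_nonempty H hval hP
        (singleton_nonempty z) ?_
      rw [card_singleton]
      omega
    · have := (h'.swap H).value_lt_of_red H hval hP hzE (by simp) hzP hzy
      rw [card_empty] at this
      omega

lemma secure_of_common_red_add_four (H : DenseFree w r) {x y : V} {E : Finset V} {m : ℕ}
    (hx : ∀ v ∈ E, w x v = 2) (hy : ∀ v ∈ E, w y v = 2) (hE : HasValue w E m)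
    (hm : 2 * r ≤ m + 4) : Secure w r x y := by
  obtain ⟨R, hRE, hR, hmax, f, hf, hsum, htri⟩ := H.exists_weights hE.1
  by_cases hk : r ≤ R.card + 2
  · exact H.secure_of_redClique hR (fun v hv => hx v (hRE hv)) (fun v hv => hy v (hRE hv)) hk
  have hE' : HasValue w E (R.card + E.card) := ⟨hE.1, R, hRE, hR, le_rfl⟩
  obtain ⟨_, R₀, hR₀, hR₀', hm₀⟩ := hE
  have hRR := hmax R₀ hR₀ hR₀'
  by_cases hlarge : 2 * r ≤ R.card + E.card + 3
  · exact H.secure_of_common_red hx hy hE' hlarge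
  have hme : R.card + E.card + 4 = 2 * r := by omega
  have hmeR : (R.card : ℝ) + E.card + 4 = 2 * r := by exact_mod_cast hme
  have hdiff : (R.card : ℝ) + 2 ≤ E.card := by
    exact_mod_cast (show R.card + 2 ≤ E.card by omega)
  obtain ⟨z, hz⟩ := H.exists_small_defect E ∅ ∅ x y f 0 0 (3 / 4) (3 / 4) hf le_rfl le_rfl
    (by norm_num) (by norm_num) (by rcases hsum with hsum | hsum <;> linarith)
  simp only [zero_mul, add_zero] at hz
  have hD0 : 0 ≤ ∑ v ∈ E, f v * (2 - (w z v : ℝ)) :=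
    sum_nonneg fun v _ => mul_nonneg (hf v) (H.defect_nonneg z v)
  specialize htri z
  set D := ∑ v ∈ E, f v * (2 - (w z v : ℝ)) with hD
  have hx0 := H.defect_nonneg z x
  have hy0 := H.defect_nonneg z y
  replace htri := htri (by linarith)
  have hno : ∀ {t}, (∀ v ∈ E, w t v = 2) → w z t = 2 → (∀ v ∈ E, w z v = 2) →
      2 * r ≤ R.card + E.card + 3 := by
    intro t ht hzt hzE
    have := H.value_add_star_lt (P := ∅) (H.hasValue_insert_red hE' hzE) (by simp [BlueClique])
      (by simp) (by simp [RedBetween]) (H.forall_mem_insert_red hzt ht)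
    rw [card_empty] at this
    omega
  have hblue : ∀ {s t}, (∀ v ∈ E, w s v = 2) → (∀ v ∈ E, w t v = 2) → w z s = 1 →
      w z t = 2 → Secure w r s t := by
    intro s t hs ht hzs hzt
    rcases htri with hzE | ⟨h1, ⟨a, ha, hza⟩, hzE⟩ | ⟨h1, e, he, -, hzE, hval⟩
    · exact absurd (hno ht hzt hzE) hlarge
    · exact (H.noWicked (hs a ha) hzs hza).elim
    · have h' : BluePairs w t s (E.erase e) ∅ ∅ :=
        BluePairs.empty (fun v hv => ht v (mem_of_mem_erase hv))
          fun v hv => hs v (mem_of_mem_erase hv)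
      refine ((h'.singleton H hzE (by simp) hzt hzs).swap H).secure_of_right_empty H hval
        (singleton_nonempty z) ?_
      rw [card_singleton]
      omega
  rcases H.weight_cases z x with hzx | hzx | hzx
  · have h2 := H.two_le_defect hzx
    have hzy : w z y = 2 := by
      by_contra hzy
      have := H.one_le_defect hzy
      linarith
    rcases htri with hzE | ⟨h1, -⟩ | ⟨h1, -⟩
    · exact absurd (hno hy hzy hzE) hlarge
    · linarith
    · linarith
  · rcases H.weight_cases z y with hzy | hzy | hzy
    · have := H.two_le_defect hzy
      have := H.one_le_defect (z := z) (v := x) (by omega)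
      linarith
    · have := H.one_le_defect (z := z) (v := x) (by omega)
      have := H.one_le_defect (z := z) (v := y) (by omega)
      rcases htri with hzE | ⟨h1, -⟩ | ⟨h1, -⟩
      · refine H.secure_of_common_blue 1 E {z} _ (card_singleton z)
          (fun u hu v hv huv => absurd ((mem_singleton.1 hu).trans (mem_singleton.1 hv).symm) huv)
          (fun v hv => by rw [mem_singleton.1 hv, H.symm, hzx])
          (fun v hv => by rw [mem_singleton.1 hv, H.symm, hzy]) hx hy
          (fun u hu v hv => by rw [mem_singleton.1 hv, H.symm, hzE u hu]) hE' (by omega)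
      · linarith
      · linarith
    · exact hblue hx hy hzx hzy
  · rcases H.weight_cases z y with hzy | hzy | hzy
    · have := H.two_le_defect hzy
      rcases htri with hzE | ⟨h1, -⟩ | ⟨h1, -⟩
      · exact absurd (hno hx hzx hzE) hlarge
      · linarith
      · linarith
    · exact (hblue hy hx hzy hzx).symm
    · rcases htri with hzE | ⟨h1, -, hzE⟩ | ⟨h1, e, he, -, hzE, hval⟩
      · exact H.secure_of_common_red (H.forall_mem_insert_red hzx hx)
          (H.forall_mem_insert_red hzy hy) (H.hasValue_insert_red hE' hzE) (by omega)
      · exact H.secure_of_common_red (H.forall_mem_insert_red hzx hx)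
          (H.forall_mem_insert_red hzy hy) (H.hasValue_insert_pos hE' hzE) (by omega)
      · exact H.secure_of_common_red
          (H.forall_mem_insert_red hzx fun v hv => hx v (mem_of_mem_erase hv))
          (H.forall_mem_insert_red hzy fun v hv => hy v (mem_of_mem_erase hv))
          (H.hasValue_insert_red hval hzE) (by omega)

/-- Adding the edge `xy` with weight `1` to a clique of value `2 * r` shows that `x` and `y`
are secure. -/
lemma secure_of_almost_clique (H : DenseFree w r) {x y : V} {R S : Finset V} (hxy : x ≠ y)
    (hw : w x y = 0) (hx : x ∈ S) (hy : y ∈ S) (hRS : R ⊆ S) (hR : RedClique w R)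
    (hS : ∀ u ∈ S, ∀ v ∈ S, u ≠ v → 1 ≤ w u v ∨ (u = x ∧ v = y) ∨ (u = y ∧ v = x))
    (hm : 2 * r ≤ R.card + S.card) : Secure w r x y := by
  set D := (S.erase x).erase y with hDdef
  have hDS : ∀ v ∈ D, v ∈ S ∧ v ≠ x ∧ v ≠ y := fun v hv => by
    simp only [hDdef, mem_erase] at hv
    tauto
  have hcD : D.card + 2 = S.card := by
    have h1 := card_erase_of_mem hx
    have h2 := card_erase_of_mem (mem_erase.2 ⟨hxy.symm, hy⟩)
    have h3 : 1 < S.card := one_lt_card.2 ⟨x, hx, y, hy, hxy⟩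
    rw [← hDdef] at h2
    omega
  have hD : PosClique w D := fun u hu v hv huv => by
    have h1 := hDS u hu
    rcases hS u h1.1 v (hDS v hv).1 huv with h | h | h
    exacts [h, absurd h.1 h1.2.1, absurd h.1 h1.2.2]
  have hxD : ∀ v ∈ D, w x v = 1 ∨ w x v = 2 := fun v hv => by
    have h1 := hDS v hv
    have h2 := H.le_two x v
    rcases hS x hx v h1.1 h1.2.1.symm with h | h | h
    · omega
    · exact absurd h.2 h1.2.2
    · exact absurd h.2 h1.2.1
  have hyD : ∀ v ∈ D, w y v = 1 ∨ w y v = 2 := fun v hv => by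
    have h1 := hDS v hv
    have h2 := H.le_two y v
    rcases hS y hy v h1.1 h1.2.2.symm with h | h | h
    · omega
    · exact absurd h.2 h1.2.2
    · exact absurd h.2 h1.2.1
  set P : Finset V := {v ∈ D | w x v = 1} with hPdef
  set Q : Finset V := {v ∈ D | w y v = 1} with hQdef
  set E : Finset V := {v ∈ D | w x v = 2 ∧ w y v = 2} with hEdef
  have hPm : ∀ v ∈ P, v ∈ D ∧ w x v = 1 := fun v hv => mem_filter.1 hv
  have hQm : ∀ v ∈ Q, v ∈ D ∧ w y v = 1 := fun v hv => mem_filter.1 hv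
  have hEm : ∀ v ∈ E, v ∈ D ∧ w x v = 2 ∧ w y v = 2 := fun v hv => mem_filter.1 hv
  have hPblue : BlueClique w P := H.blueClique_filter hD x
  have hQblue : BlueClique w Q := H.blueClique_filter hD y
  have hne : ∀ {u v t}, w t u = 1 → w t v = 2 → u ≠ v := by
    rintro u v t h1 h2 rfl
    omega
  have hEP : RedBetween w E P := H.redBetween_comm fun u hu v hv =>
    H.red_of_blue_of_red (hPm u hu).2 (hEm v hv).2.1
      (hD u (hPm u hu).1 v (hEm v hv).1 (hne (hPm u hu).2 (hEm v hv).2.1))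
  have hEQ : RedBetween w E Q := H.redBetween_comm fun u hu v hv =>
    H.red_of_blue_of_red (hQm u hu).2 (hEm v hv).2.2
      (hD u (hQm u hu).1 v (hEm v hv).1 (hne (hQm u hu).2 (hEm v hv).2.2))
  have hE : HasValue w E ((R ∩ E).card + E.card) :=
    ⟨fun u hu v hv => hD u (hEm u hu).1 v (hEm v hv).1, R ∩ E, inter_subset_right,
      fun u hu v hv => hR u (mem_inter.1 hu).1 v (mem_inter.1 hv).1, le_rfl⟩
  have hcover : R ⊆ (R ∩ E) ∪ (R ∩ insert x P) ∪ (R ∩ insert y Q) := by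
    intro v hv
    simp only [mem_union, mem_inter, mem_insert]
    by_cases hvx : v = x
    · tauto
    by_cases hvy : v = y
    · tauto
    have hvD : v ∈ D := mem_erase.2 ⟨hvy, mem_erase.2 ⟨hvx, hRS hv⟩⟩
    simp only [hPdef, hQdef, hEdef, mem_filter]
    have h1 := hxD v hvD
    have h2 := hyD v hvD
    tauto
  have hcoverD : D ⊆ E ∪ P ∪ Q := by
    intro v hv
    simp only [mem_union, hPdef, hQdef, hEdef, mem_filter]
    have h1 := hxD v hv
    have h2 := hyD v hv
    tauto
  by_cases hPQ : ∃ a ∈ P, a ∈ Q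
  · obtain ⟨a, haP, haQ⟩ := hPQ
    have hPy : ∀ v ∈ P, w y v = 1 := by
      intro v hv
      by_cases hav : a = v
      · exact hav ▸ (hQm a haQ).2
      · have h1 : w y v ≠ 2 := H.not_red_of_blue (hPblue a haP v hv hav) (hQm a haQ).2
        have h2 := hyD v (hPm v hv).1
        tauto
    have hQx : Q ⊆ P := by
      intro v hv
      refine mem_filter.2 ⟨(hQm v hv).1, ?_⟩
      by_cases hav : a = v
      · exact hav ▸ (hPm a haP).2
      · have h1 : w x v ≠ 2 := H.not_red_of_blue (hQblue a haQ v hv hav) (hPm a haP).2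
        have h2 := hxD v (hQm v hv).1
        tauto
    refine H.secure_of_common_blue _ E P _ rfl hPblue (fun v hv => (hPm v hv).2) hPy
      (fun v hv => (hEm v hv).2.1) (fun v hv => (hEm v hv).2.2) hEP hE ?_
    have h1 : (R ∩ insert x (insert y P)).card ≤ 1 := by
      refine card_inter_le_one hR ?_
      intro u hu v hv huv
      simp only [mem_insert] at hu hv
      have hPx' : ∀ v ∈ P, w v x = 1 := fun v hv => by rw [H.symm, (hPm v hv).2]
      have hPy' : ∀ v ∈ P, w v y = 1 := fun v hv => by rw [H.symm, hPy v hv]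
      have hw' : w y x = 0 := by rw [H.symm, hw]
      rcases hu with rfl | rfl | hu <;> rcases hv with rfl | rfl | hv
      · exact absurd rfl huv
      · omega
      · rw [(hPm v hv).2]; omega
      · omega
      · exact absurd rfl huv
      · rw [hPy v hv]; omega
      · rw [hPx' u hu]; omega
      · rw [hPy' u hu]; omega
      · rw [hPblue u hu v hv huv]; omega
    have h2 : R ⊆ (R ∩ E) ∪ (R ∩ insert x (insert y P)) := by
      intro v hv
      have h3 := hcover hv
      have h4 := @hQx v
      simp only [mem_union, mem_inter, mem_insert] at h3 ⊢
      tauto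
    have h3 := (card_le_card h2).trans (card_union_le _ _)
    have h4 : D ⊆ E ∪ P := by
      intro v hv
      have h5 := hcoverD hv
      have h6 := @hQx v
      simp only [mem_union] at h5 ⊢
      tauto
    have h5 := (card_le_card h4).trans (card_union_le _ _)
    omega
  · push Not at hPQ
    have hPy : ∀ v ∈ P, w y v = 2 := fun v hv => by
      rcases hyD v (hPm v hv).1 with h | h
      · exact absurd (mem_filter.2 ⟨(hPm v hv).1, h⟩) (hPQ v hv)
      · exact h
    have hQx : ∀ v ∈ Q, w x v = 2 := fun v hv => by
      rcases hxD v (hQm v hv).1 with h | h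
      · exact absurd hv (hPQ v (mem_filter.2 ⟨(hQm v hv).1, h⟩))
      · exact h
    have h : BluePairs w x y E P Q :=
      ⟨fun v hv => (hPm v hv).2, fun v hv => (hQm v hv).2, hPblue, hQblue,
        fun v hv => (hEm v hv).2.1, fun v hv => (hEm v hv).2.2, hQx, hPy, hEP, hEQ,
        fun u hu v hv => H.red_of_blue_of_red (hPm u hu).2 (hQx v hv)
          (hD u (hPm u hu).1 v (hQm v hv).1 (hne (hPm u hu).2 (hQx v hv)))⟩
    have hval : 2 * r ≤ (R ∩ E).card + E.card + P.card + Q.card + 4 := by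
      have h1 := (card_le_card hcover).trans ((card_union_le _ _).trans
        (Nat.add_le_add_right (card_union_le _ _) _))
      have h2 := (card_le_card hcoverD).trans ((card_union_le _ _).trans
        (Nat.add_le_add_right (card_union_le _ _) _))
      have h3 : ∀ {t} {T : Finset V}, BlueClique w T → (∀ v ∈ T, w t v = 1) →
          (R ∩ insert t T).card ≤ 1 := fun hT ht =>
        card_inter_le_one hR fun u hu v hv huv => by
          rw [H.blueClique_insert hT ht u hu v hv huv]
          omega
      have h4 := h3 hPblue h.bluex
      have h5 := h3 hQblue h.bluey
      omega
    rcases P.eq_empty_or_nonempty with hP | hP <;> rcases Q.eq_empty_or_nonempty with hQ | hQ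
    · rw [hP, hQ, card_empty] at hval
      exact H.secure_of_common_red_add_four h.redx h.redy hE hval
    · rw [hP] at h hval
      rw [card_empty] at hval
      exact ((h.swap H).secure_of_right_empty H hE hQ (by omega)).symm
    · rw [hQ] at h hval
      rw [card_empty] at hval
      exact h.secure_of_right_empty H hE hP (by omega)
    · exact (h.false_of_nonempty H hE hP hQ hval).elim

lemma secure_of_extremal (H : DenseFree w r) (hG : IsColoured w) (hext : Extremal w r) {x y : V}
    (hxy : x ≠ y) (hw : w x y = 0) : Secure w r x y := by
  set w' : V → V → ℕ := fun u v => if (u = x ∧ v = y) ∨ (u = y ∧ v = x) then 1 else w u v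
    with hw'def
  have hw'xy : w' x y = 1 := by simp [hw'def]
  have hcases : ∀ u v, (((u = x ∧ v = y) ∨ (u = y ∧ v = x)) ∧ w' u v = 1 ∧ w u v = 0) ∨
      w' u v = w u v := by
    intro u v
    by_cases h : (u = x ∧ v = y) ∨ (u = y ∧ v = x)
    · refine Or.inl ⟨h, if_pos h, ?_⟩
      rcases h with ⟨rfl, rfl⟩ | ⟨rfl, rfl⟩
      · exact hw
      · rw [H.symm, hw]
    · exact Or.inr (if_neg h)
  have hnot : ¬ FamFree w' (2 * r) := by
    intro hfree
    have h := hext.2 w' ⟨fun u v => ?_, fun u v => ?_, fun u => ?_⟩ (fun u v => ?_) hfree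
    · rw [h, hw] at hw'xy
      omega
    · simp only [hw'def, hG.1 u v]
      congr 1
      rw [eq_iff_iff]
      tauto
    · have := hG.2.1 u v
      rcases hcases u v with h | h <;> omega
    · rcases hcases u u with ⟨⟨rfl, h⟩ | ⟨rfl, h⟩, -⟩ | h
      · exact absurd h hxy
      · exact absurd h hxy.symm
      · rw [h, hG.2.2]
    · rcases hcases u v with h | h <;> omega
  simp only [FamFree, not_forall, not_not] at hnot
  obtain ⟨i, hi, hir, φ, hφ, hle⟩ := hnot
  set S : Finset V := univ.image φ with hSdef
  set R : Finset V := (univ.filter fun a : Fin (2 * r - i) => a.val < i).image φ with hRdef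
  have hSc : S.card = 2 * r - i := by
    rw [hSdef, card_image_of_injective _ hφ, card_univ, Fintype.card_fin]
  have hRc : R.card = i := by
    rw [hRdef, card_image_of_injective _ hφ, Fin.card_filter_val_lt]
    omega
  have hRS : R ⊆ S := image_subset_image (filter_subset _ _)
  have hR : RedClique w R := by
    intro u hu v hv huv
    simp only [hRdef, mem_image, mem_filter, mem_univ, true_and] at hu hv
    obtain ⟨a, ha, rfl⟩ := hu
    obtain ⟨b, hb, rfl⟩ := hv
    have hab : a ≠ b := fun h => huv (congrArg φ h)
    have h1 := hle a b
    simp only [Gt, hab, ha, hb, if_false, and_self, if_true] at h1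
    have h2 := H.le_two (φ a) (φ b)
    rcases hcases (φ a) (φ b) with h | h <;> omega
  have hS : ∀ u ∈ S, ∀ v ∈ S, u ≠ v → 1 ≤ w u v ∨ (u = x ∧ v = y) ∨ (u = y ∧ v = x) := by
    intro u hu v hv huv
    simp only [hSdef, mem_image, mem_univ, true_and] at hu hv
    obtain ⟨a, rfl⟩ := hu
    obtain ⟨b, rfl⟩ := hv
    have hab : a ≠ b := fun h => huv (congrArg φ h)
    have h1 : 1 ≤ w' (φ a) (φ b) := by
      refine le_trans ?_ (hle a b)
      simp only [Gt, hab, if_false]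
      split_ifs <;> omega
    rcases hcases (φ a) (φ b) with h | h
    · exact Or.inr h.1
    · exact Or.inl (h ▸ h1)
  have hxyS : x ∈ S ∧ y ∈ S := by
    by_contra hxyS
    refine H.free S ⟨fun u hu v hv huv => ?_, R, hRS, hR, by omega⟩
    rcases hS u hu v hv huv with h | ⟨rfl, rfl⟩ | ⟨rfl, rfl⟩
    · exact h
    · exact absurd ⟨hu, hv⟩ hxyS
    · exact absurd ⟨hv, hu⟩ hxyS
  exact H.secure_of_almost_clique hxy hw hxyS.1 hxyS.2 hRS hR hS (by omega)

end DenseFree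

end

/-- Lemma: in an extremal `𝓕_{2r}`-free coloured graph with minimum degree greater than
`((14r-24)/(7r-5))·n` containing no blue wicked triangle, every green edge (weight `0`)
is secure. -/
theorem green_edges_secure {V : Type*} [Fintype V] (r : ℕ) (hr : 3 ≤ r)
    (w : V → V → ℕ) (hG : IsColoured w) (hext : Extremal w r)
    (hdeg : ∀ x : V,
      (14 * (r : ℝ) - 24) / (7 * (r : ℝ) - 5) * (Fintype.card V : ℝ) < ∑ y : V, (w x y : ℝ))
    (hnoblue : ∀ x y z : V, x ≠ y → x ≠ z → y ≠ z →
      ¬ (w x y = 2 ∧ w x z = 1 ∧ w y z = 1)) :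
    ∀ x y : V, x ≠ y → w x y = 0 → Secure w r x y := by
  classical
  intro x y hxy hw
  have hr3 : (3 : ℝ) ≤ r := by exact_mod_cast hr
  have hk : (0 : ℝ) < 7 * r - 5 := by linarith
  have hpos : ∀ {u v : V}, 0 < w u v → u ≠ v := by
    rintro u v h rfl
    rw [hG.2.2] at h
    omega
  have H : DenseFree w r :=
    { symm := hG.1
      le_two := hG.2.1
      self := hG.2.2
      noWicked := fun {u v z} huv hzu hzv =>
        hnoblue u v z (hpos (by omega)) (hpos (by omega)).symm (hpos (by omega)).symm
          ⟨huv, by rw [hG.1, hzu], by rw [hG.1, hzv]⟩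
      free := not_hasValue_of_famFree hr hext.1
      three_le := hr
      defect_lt := fun v => by
        have h1 := hdeg v
        rw [div_mul_eq_mul_div, div_lt_iff₀ hk] at h1
        simp only [Finset.sum_sub_distrib, Finset.sum_const, Finset.card_univ, nsmul_eq_mul,
          hG.1 _ v]
        linarith }
  exact H.secure_of_extremal hG hext hxy hw
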